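/- arXiv:1411.0321 — 8 statements merged into one kernel-verified Lean document; each statement's English description precedes it below -/
import Mathlib

section
/- Let x, z ∈ ℝ and y < 0. Then the function Φ(τ,x,y,z), defined for τ ∈ [0,1), is differentiable on [0,1) and satisfies the Levin ODE (1-τ)³ Φ'(τ,x,y,z) + [σ(τ,x,y,z) - (1-τ)²] Φ(τ,x,y,z) = 1 for every τ ∈ [0,1). -/
open MeasureTheory Set


noncomputable def wSigma (τ x y z : ℝ) : ℂ :=
  Complex.I * (x : ℂ) * ((τ * (1 - τ) / Real.sqrt (2 * τ ^ 2 - 2 * τ + 1) : ℝ) : ℂ)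
    + 2 * (y : ℂ) * (τ : ℂ)
    + Complex.I * (z : ℂ) * (((3 * τ ^ 2 - 2 * τ + 1) / Real.sqrt (2 * τ ^ 2 - 2 * τ + 1) : ℝ) : ℂ)

noncomputable def wLam (τ x y z : ℝ) : ℂ :=
  -(((τ : ℂ) - 1) ^ 2)⁻¹ * ((y : ℂ) + Complex.I * (z : ℂ) * ((τ * Real.sqrt (2 * τ ^ 2 - 2 * τ + 1) : ℝ) : ℂ))
    - ((τ : ℂ) - 1)⁻¹ * (2 * (y : ℂ) - Complex.I * (x : ℂ) * ((Real.sqrt (2 * τ ^ 2 - 2 * τ + 1) : ℝ) : ℂ))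

noncomputable def wPhi (τ x y z : ℝ) : ℂ :=
  Complex.exp (wLam τ x y z) / ((τ : ℂ) - 1) *
    ∫ θ in τ..1, Complex.exp (-(wLam θ x y z)) / ((θ : ℂ) - 1) ^ 2

lemma sqrt_arg_pos (τ : ℝ) : 0 < 2 * τ ^ 2 - 2 * τ + 1 := by
  nlinarith [sq_nonneg (2 * τ - 1)]

lemma hasDerivAt_sqrt_quadratic (τ : ℝ) :
    HasDerivAt (fun s : ℝ => Real.sqrt (2 * s ^ 2 - 2 * s + 1))
      ((2 * τ - 1) / Real.sqrt (2 * τ ^ 2 - 2 * τ + 1)) τ := by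
  have hpoly : HasDerivAt (fun s : ℝ => 2 * s ^ 2 - 2 * s + 1) (2 * (2 * τ) - 2) τ := by
    have h := (((hasDerivAt_pow 2 τ).const_mul 2).sub ((hasDerivAt_id τ).const_mul 2)).add_const 1
    exact h.congr_deriv (by norm_num)
  convert hpoly.sqrt (sqrt_arg_pos τ).ne' using 1
  have := Real.sqrt_pos.2 (sqrt_arg_pos τ)
  field_simp

lemma hasDerivAt_wLam (x y z : ℝ) {τ : ℝ} (hτ : τ ≠ 1) :
    HasDerivAt (fun s : ℝ => wLam s x y z) (-wSigma τ x y z / (1 - (τ : ℂ)) ^ 3) τ := by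
  have hne : (τ : ℂ) - 1 ≠ 0 := sub_ne_zero.2 (by exact_mod_cast hτ)
  have hR := hasDerivAt_sqrt_quadratic τ
  have hτR := ((hasDerivAt_id τ).mul hR).ofReal_comp
  have hsub : HasDerivAt (fun s : ℝ => (s : ℂ) - 1) 1 τ :=
    (hasDerivAt_id τ).ofReal_comp.sub_const 1
  have h := ((((hsub.pow 2).inv (pow_ne_zero 2 hne)).neg).mul
    ((hτR.const_mul (Complex.I * z)).const_add (y : ℂ))).sub
    ((hsub.inv hne).mul ((hR.ofReal_comp.const_mul (Complex.I * x)).const_sub (2 * (y : ℂ))))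
  refine h.congr_deriv ?_
  have hRpos := Real.sqrt_pos.2 (sqrt_arg_pos τ)
  have hsq : ((Real.sqrt (2 * τ ^ 2 - 2 * τ + 1) : ℝ) : ℂ) ^ 2 = 2 * (τ : ℂ) ^ 2 - 2 * τ + 1 := by
    exact_mod_cast Real.sq_sqrt (sqrt_arg_pos τ).le
  have hRne : ((Real.sqrt (2 * τ ^ 2 - 2 * τ + 1) : ℝ) : ℂ) ≠ 0 := by exact_mod_cast hRpos.ne'
  have hcube : (1 - (τ : ℂ)) ^ 3 = -((τ : ℂ) - 1) ^ 3 := by ring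
  rw [hcube]
  simp only [wSigma, id, Pi.mul_apply, Pi.pow_apply, Pi.neg_apply, Pi.inv_apply]
  push_cast
  generalize ((Real.sqrt (2 * τ ^ 2 - 2 * τ + 1) : ℝ) : ℂ) = R at hsq hRne ⊢
  field_simp
  linear_combination Complex.I * (τ * z - τ * x + z + x) * hsq

lemma re_wLam (τ x y z : ℝ) :
    (wLam τ x y z).re = -((τ - 1) ^ 2)⁻¹ * y - (τ - 1)⁻¹ * (2 * y) := by
  have h : wLam τ x y z = ((-((τ - 1) ^ 2)⁻¹ * y - (τ - 1)⁻¹ * (2 * y) : ℝ) : ℂ) +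
      (((-((τ - 1) ^ 2)⁻¹ * (z * (τ * Real.sqrt (2 * τ ^ 2 - 2 * τ + 1))) +
        (τ - 1)⁻¹ * (x * Real.sqrt (2 * τ ^ 2 - 2 * τ + 1)) : ℝ)) : ℂ) * Complex.I := by
    simp only [wLam]
    push_cast
    ring
  rw [h]
  simp only [Complex.add_re, Complex.ofReal_re, Complex.re_ofReal_mul, Complex.I_re, mul_zero,
    add_zero]

lemma norm_integrand_le (x z θ : ℝ) {y : ℝ} (hy : y < 0) :
    ‖Complex.exp (-(wLam θ x y z)) / ((θ : ℂ) - 1) ^ 2‖ ≤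
      Real.exp (-y) * (2 / (-y) + 2) := by
  have hnorm : ‖((θ : ℂ) - 1) ^ 2‖ = (θ - 1) ^ 2 := by
    rw [norm_pow, ← Complex.ofReal_one, ← Complex.ofReal_sub, Complex.norm_real, Real.norm_eq_abs,
      sq_abs]
  rw [norm_div, Complex.norm_exp, hnorm, Complex.neg_re, re_wLam, div_eq_mul_inv, ← inv_pow]
  generalize (θ - 1)⁻¹ = t
  have hexp : -(-t ^ 2 * y - t * (2 * y)) = -y + y * (t + 1) ^ 2 := by ring
  rw [hexp, Real.exp_add, mul_assoc]
  refine mul_le_mul_of_nonneg_left ?_ (Real.exp_pos _).le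
  have hle : Real.exp (y * (t + 1) ^ 2) ≤ 1 :=
    Real.exp_le_one_iff.2 (mul_nonpos_of_nonpos_of_nonneg hy.le (sq_nonneg _))
  have hmul : Real.exp (y * (t + 1) ^ 2) * (-y * (t + 1) ^ 2) ≤ 1 := by
    have h := Real.add_one_le_exp (-y * (t + 1) ^ 2)
    calc Real.exp (y * (t + 1) ^ 2) * (-y * (t + 1) ^ 2)
        ≤ Real.exp (y * (t + 1) ^ 2) * Real.exp (-y * (t + 1) ^ 2) :=
          mul_le_mul_of_nonneg_left (by linarith) (Real.exp_pos _).le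
      _ = 1 := by rw [← Real.exp_add, neg_mul, add_neg_cancel, Real.exp_zero]
  have hmul' : Real.exp (y * (t + 1) ^ 2) * (t + 1) ^ 2 ≤ 1 / (-y) := by
    rw [le_div_iff₀ (neg_pos.2 hy)]
    linarith
  have ht : t ^ 2 ≤ 2 * (t + 1) ^ 2 + 2 := by nlinarith [sq_nonneg (t + 2)]
  calc Real.exp (y * (t + 1) ^ 2) * t ^ 2
      ≤ Real.exp (y * (t + 1) ^ 2) * (2 * (t + 1) ^ 2 + 2) :=
        mul_le_mul_of_nonneg_left ht (Real.exp_pos _).le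
    _ = 2 * (Real.exp (y * (t + 1) ^ 2) * (t + 1) ^ 2) + 2 * Real.exp (y * (t + 1) ^ 2) := by ring
    _ ≤ 2 * (1 / (-y)) + 2 * 1 := by gcongr
    _ = 2 / (-y) + 2 := by ring

lemma measurable_integrand (x y z : ℝ) :
    Measurable fun θ : ℝ => Complex.exp (-(wLam θ x y z)) / ((θ : ℂ) - 1) ^ 2 := by
  unfold wLam
  fun_prop

lemma intervalIntegrable_integrand (x z a b : ℝ) {y : ℝ} (hy : y < 0) :
    IntervalIntegrable (fun θ : ℝ => Complex.exp (-(wLam θ x y z)) / ((θ : ℂ) - 1) ^ 2)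
      volume a b :=
  (intervalIntegrable_const (c := Real.exp (-y) * (2 / (-y) + 2))).mono_fun'
    (measurable_integrand x y z).aestronglyMeasurable
    (Filter.Eventually.of_forall fun θ => norm_integrand_le x z θ hy)

/-- For `y < 0`, the function `Φ(·,x,y,z)` is differentiable on `[0,1)` and satisfies the
Levin ODE `(1-τ)³ Φ' + [σ - (1-τ)²] Φ = 1` there. -/
theorem wPhi_solves_levin_ODE (x y z : ℝ) (hy : y < 0) :
    ∀ τ ∈ Set.Ico (0 : ℝ) 1, ∃ d : ℂ,
      HasDerivWithinAt (fun s : ℝ => wPhi s x y z) d (Set.Ico (0 : ℝ) 1) τ ∧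
      (1 - (τ : ℂ)) ^ 3 * d + (wSigma τ x y z - (1 - (τ : ℂ)) ^ 2) * wPhi τ x y z = 1 := by
  intro τ hτ
  have hne : (τ : ℂ) - 1 ≠ 0 := sub_ne_zero.2 (by exact_mod_cast hτ.2.ne)
  have hne' : 1 - (τ : ℂ) ≠ 0 := sub_ne_zero.2 (by exact_mod_cast hτ.2.ne')
  have hΛ := hasDerivAt_wLam x y z hτ.2.ne
  have hsub : HasDerivAt (fun s : ℝ => (s : ℂ) - 1) 1 τ :=
    (hasDerivAt_id τ).ofReal_comp.sub_const 1
  have hcont : ContinuousAt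
      (fun θ : ℝ => Complex.exp (-(wLam θ x y z)) / ((θ : ℂ) - 1) ^ 2) τ :=
    hΛ.continuousAt.neg.cexp.div (hsub.continuousAt.pow 2) (pow_ne_zero 2 hne)
  have hint := intervalIntegral.integral_hasDerivAt_left
    (intervalIntegrable_integrand x z τ 1 hy)
    (measurable_integrand x y z).stronglyMeasurable.stronglyMeasurableAtFilter hcont
  refine ⟨_, ((hΛ.cexp.div hsub hne).mul hint).hasDerivWithinAt, ?_⟩
  simp only [wPhi, Pi.div_apply]
  rw [Complex.exp_neg]
  generalize (∫ θ in τ..1, Complex.exp (-(wLam θ x y z)) / ((θ : ℂ) - 1) ^ 2) = J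
  have hE := Complex.exp_ne_zero (wLam τ x y z)
  generalize Complex.exp (wLam τ x y z) = E at hE ⊢
  field_simp
  ring
end

section
/- Let x, z ∈ ℝ and y < 0. If u₁ and u₂ are differentiable functions from [0,1) to ℂ, both bounded on [0,1), and both satisfy the Levin ODE (1-τ)³ u'(τ) + [σ(τ,x,y,z) - (1-τ)²] u(τ) = 1 for all τ ∈ [0,1), then u₁ = u₂ on [0,1). (Every other solution differs by a multiple of e^{Λ(τ,x,y,z)}/(τ-1), which is unbounded as τ → 1⁻ when y < 0.) -/
open MeasureTheory Set

theorem wSigma_re (τ x y z : ℝ) : (wSigma τ x y z).re = 2 * y * τ := by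
  simp only [wSigma, Complex.add_re, Complex.mul_re, Complex.mul_im, Complex.I_re, Complex.I_im,
    Complex.ofReal_re, Complex.ofReal_im, Complex.re_ofNat, Complex.im_ofNat]
  ring

theorem Complex.real_inner_mul_self (c w : ℂ) : inner ℝ w (c * w) = c.re * ‖w‖ ^ 2 := by
  rw [Complex.inner, ← Complex.normSq_eq_norm_sq, mul_assoc, Complex.mul_conj,
    Complex.re_mul_ofReal]

/-- The homogeneous Levin equation forces `(1 - τ)² ‖w‖²` to be nondecreasing when `y ≤ 0`. -/
theorem monotoneOn_sq_mul_norm_sq_of_levin_homogeneous {x y z : ℝ} (hy : y ≤ 0) {w w' : ℝ → ℂ}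
    (hd : ∀ τ ∈ Ico (0 : ℝ) 1, HasDerivWithinAt w (w' τ) (Ico (0 : ℝ) 1) τ)
    (hode : ∀ τ ∈ Ico (0 : ℝ) 1,
      (1 - (τ : ℂ)) ^ 3 * w' τ + (wSigma τ x y z - (1 - (τ : ℂ)) ^ 2) * w τ = 0) :
    MonotoneOn (fun τ ↦ (1 - τ) ^ 2 * ‖w τ‖ ^ 2) (Ico (0 : ℝ) 1) := by
  have hderiv : ∀ τ ∈ Ico (0 : ℝ) 1, HasDerivWithinAt (fun τ ↦ (1 - τ) ^ 2 * ‖w τ‖ ^ 2)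
      (-2 * (1 - τ) * ‖w τ‖ ^ 2 + (1 - τ) ^ 2 * (2 * inner ℝ (w τ) (w' τ)))
      (Ico (0 : ℝ) 1) τ := fun τ hτ ↦ by
    have h := (((hasDerivAt_id τ).const_sub 1).pow 2).hasDerivWithinAt (s := Ico (0 : ℝ) 1)
    refine (h.mul (hd τ hτ).norm_sq).congr_deriv ?_
    simp
  refine monotoneOn_of_hasDerivWithinAt_nonneg (convex_Ico 0 1)
    (fun τ hτ ↦ (hderiv τ hτ).continuousWithinAt)
    (fun τ hτ ↦ (hderiv τ (interior_subset hτ)).mono interior_subset) fun τ hτ ↦ ?_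
  have hτ := interior_subset hτ
  have h1 : 0 < 1 - τ := sub_pos.2 hτ.2
  have hinner : (1 - τ) ^ 3 * inner ℝ (w τ) (w' τ) =
      ((1 - τ) ^ 2 - 2 * y * τ) * ‖w τ‖ ^ 2 := by
    have hw' : ((1 - τ) ^ 3 : ℝ) • w' τ =
        ((((1 - τ) ^ 2 : ℝ) : ℂ) - wSigma τ x y z) * w τ := by
      rw [Complex.real_smul]
      push_cast
      linear_combination hode τ hτ
    rw [← real_inner_smul_right, hw', Complex.real_inner_mul_self, Complex.sub_re,
      Complex.ofReal_re, wSigma_re]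
  refine (mul_nonneg_iff_of_pos_left h1).1 ?_
  calc (0 : ℝ) ≤ 4 * (-y * τ) * ‖w τ‖ ^ 2 := by
        have := mul_nonneg (neg_nonneg.2 hy) hτ.1
        positivity
    _ = _ := by linear_combination -2 * hinner

/-- Uniqueness of the bounded solution of the Levin ODE on `[0,1)` for `y < 0`: any two
differentiable, bounded solutions coincide on `[0,1)`. -/
theorem levin_ODE_bounded_solution_unique (x y z : ℝ) (hy : y < 0)
    (u₁ u₂ u₁' u₂' : ℝ → ℂ)
    (hd₁ : ∀ τ ∈ Set.Ico (0 : ℝ) 1, HasDerivWithinAt u₁ (u₁' τ) (Set.Ico (0 : ℝ) 1) τ)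
    (hd₂ : ∀ τ ∈ Set.Ico (0 : ℝ) 1, HasDerivWithinAt u₂ (u₂' τ) (Set.Ico (0 : ℝ) 1) τ)
    (hb₁ : ∃ C : ℝ, ∀ τ ∈ Set.Ico (0 : ℝ) 1, ‖u₁ τ‖ ≤ C)
    (hb₂ : ∃ C : ℝ, ∀ τ ∈ Set.Ico (0 : ℝ) 1, ‖u₂ τ‖ ≤ C)
    (hODE₁ : ∀ τ ∈ Set.Ico (0 : ℝ) 1,
      (1 - (τ : ℂ)) ^ 3 * u₁' τ + (wSigma τ x y z - (1 - (τ : ℂ)) ^ 2) * u₁ τ = 1)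
    (hODE₂ : ∀ τ ∈ Set.Ico (0 : ℝ) 1,
      (1 - (τ : ℂ)) ^ 3 * u₂' τ + (wSigma τ x y z - (1 - (τ : ℂ)) ^ 2) * u₂ τ = 1) :
    ∀ τ ∈ Set.Ico (0 : ℝ) 1, u₁ τ = u₂ τ := by
  obtain ⟨C₁, hC₁⟩ := hb₁
  obtain ⟨C₂, hC₂⟩ := hb₂
  have hmono := monotoneOn_sq_mul_norm_sq_of_levin_homogeneous (x := x) (z := z) hy.le
    (w := fun τ ↦ u₁ τ - u₂ τ) (w' := fun τ ↦ u₁' τ - u₂' τ)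
    (fun τ hτ ↦ (hd₁ τ hτ).sub (hd₂ τ hτ))
    (fun τ hτ ↦ by linear_combination hODE₁ τ hτ - hODE₂ τ hτ)
  intro τ hτ
  have h1 : 0 < 1 - τ := sub_pos.2 hτ.2
  have hbound : ∀ᶠ s in nhdsWithin 1 (Iio 1),
      (1 - τ) ^ 2 * ‖u₁ τ - u₂ τ‖ ^ 2 ≤ (1 - s) ^ 2 * (C₁ + C₂) ^ 2 := by
    filter_upwards [Ico_mem_nhdsLT hτ.2] with s hs
    have hs' : s ∈ Ico (0 : ℝ) 1 := ⟨hτ.1.trans hs.1, hs.2⟩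
    refine (hmono hτ hs' hs.1).trans ?_
    have hw : ‖u₁ s - u₂ s‖ ≤ C₁ + C₂ :=
      (norm_sub_le _ _).trans (add_le_add (hC₁ s hs') (hC₂ s hs'))
    dsimp only
    gcongr
  have hlim : Filter.Tendsto (fun s : ℝ ↦ (1 - s) ^ 2 * (C₁ + C₂) ^ 2)
      (nhdsWithin 1 (Iio 1)) (nhds 0) := by
    have hcont : Continuous fun s : ℝ ↦ (1 - s) ^ 2 * (C₁ + C₂) ^ 2 := by fun_prop
    simpa using (hcont.tendsto 1).mono_left nhdsWithin_le_nhds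
  have hle := ge_of_tendsto hlim hbound
  have hzero : ‖u₁ τ - u₂ τ‖ ^ 2 = 0 :=
    le_antisymm (nonpos_of_mul_nonpos_right hle (pow_pos h1 2)) (sq_nonneg _)
  exact sub_eq_zero.1 (norm_eq_zero.1 (pow_eq_zero_iff two_ne_zero |>.1 hzero))
end

section
/- Let x, y, z ∈ ℝ and set γ₂ = -y - iz, γ₁ = ix - 2y - 2iz, γ₀ = ix - 3iz/2. Then there exists a constant C ≥ 0 (depending on x, y, z) such that for all θ ∈ [0,1): |Λ(θ,x,y,z) - γ₂/(θ-1)² - γ₁/(θ-1) - γ₀| ≤ C·(1-θ). -/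
open MeasureTheory Set

/-- Second-order Taylor estimate at `u = 0` of `√(2τ² - 2τ + 1)` with `τ = 1 + u`. -/
theorem abs_sqrt_sub_taylor_le {u : ℝ} (h₁ : -1 ≤ u) (h₀ : u ≤ 0) :
    |Real.sqrt (2 * (1 + u) ^ 2 - 2 * (1 + u) + 1) - (1 + u + u ^ 2 / 2)| ≤ 5 / 2 * (-u) ^ 3 := by
  set s := Real.sqrt (2 * (1 + u) ^ 2 - 2 * (1 + u) + 1)
  have hs0 : 0 ≤ s := Real.sqrt_nonneg _
  have hsq : s ^ 2 = 2 * (1 + u) ^ 2 - 2 * (1 + u) + 1 :=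
    Real.sq_sqrt (by nlinarith [sq_nonneg u, sq_nonneg (1 + u)])
  have hden : 1 / 2 ≤ s + (1 + u + u ^ 2 / 2) := by nlinarith [sq_nonneg (1 + u)]
  have hcube : 0 ≤ (-u) ^ 3 := pow_nonneg (by linarith) 3
  have hprod : (s - (1 + u + u ^ 2 / 2)) * (s + (1 + u + u ^ 2 / 2)) = (-u) ^ 3 * (1 + u / 4) := by
    linear_combination hsq
  have hle : |s - (1 + u + u ^ 2 / 2)| * (s + (1 + u + u ^ 2 / 2)) ≤ (-u) ^ 3 := by
    rw [← abs_of_nonneg (show 0 ≤ s + (1 + u + u ^ 2 / 2) by linarith), ← abs_mul,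
      hprod, abs_of_nonneg (mul_nonneg hcube (by linarith))]
    nlinarith
  nlinarith [mul_le_mul_of_nonneg_left hden (abs_nonneg (s - (1 + u + u ^ 2 / 2)))]

/-- Expansion of `Λ` at `τ = 1`: with `γ₂ = -y - iz`, `γ₁ = ix - 2y - 2iz`, `γ₀ = ix - 3iz/2`,
the remainder `Λ(θ) - γ₂/(θ-1)² - γ₁/(θ-1) - γ₀` is `O(1-θ)` on `[0,1)`. -/
theorem wLam_expansion_at_one (x y z : ℝ) :
    ∃ C : ℝ, 0 ≤ C ∧ ∀ θ ∈ Set.Ico (0 : ℝ) 1,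
      ‖wLam θ x y z -
          ((-(y : ℂ) - Complex.I * (z : ℂ)) / ((θ : ℂ) - 1) ^ 2 +
            (Complex.I * (x : ℂ) - 2 * (y : ℂ) - 2 * Complex.I * (z : ℂ)) / ((θ : ℂ) - 1) +
            (Complex.I * (x : ℂ) - 3 * Complex.I * (z : ℂ) / 2))‖ ≤ C * (1 - θ) := by
  refine ⟨3 * |x| + 3 * |z|, by positivity, ?_⟩
  rintro θ ⟨h0, h1⟩
  obtain ⟨u, rfl⟩ : ∃ u, θ = 1 + u := ⟨θ - 1, by ring⟩
  have hu : u ≠ 0 := by rintro rfl; simp at h1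
  have hneg : 0 < -u := by linarith
  have hr := abs_le.mp (abs_sqrt_sub_taylor_le (u := u) (by linarith) (by linarith))
  unfold wLam
  set s := Real.sqrt (2 * (1 + u) ^ 2 - 2 * (1 + u) + 1)
  have hx : |(s - 1 - u) / u| ≤ 3 * (-u) := by
    rw [abs_div, abs_of_neg (show u < 0 by linarith), div_le_iff₀ hneg, abs_le]
    have : (-u) ^ 3 ≤ (-u) ^ 2 := pow_le_pow_of_le_one hneg.le (by linarith) (by norm_num)
    constructor <;> nlinarith
  have hz : |((1 + u) * s - 1 - 2 * u - 3 * u ^ 2 / 2) / u ^ 2| ≤ 3 * (-u) := by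
    rw [abs_div, abs_of_pos (show 0 < u ^ 2 by positivity), div_le_iff₀ (by positivity), abs_le]
    have hcube : 0 < (-u) ^ 3 := by positivity
    have hl := mul_le_mul_of_nonneg_left hr.1 h0
    have hh := mul_le_mul_of_nonneg_left hr.2 h0
    have hc : (1 + u) * (-u) ^ 3 ≤ (-u) ^ 3 := by nlinarith
    constructor <;> nlinarith
  have huC : (u : ℂ) ≠ 0 := by exact_mod_cast hu
  have key : ∀ w : ℂ, w = Complex.I * ((x * ((s - 1 - u) / u)
      - z * (((1 + u) * s - 1 - 2 * u - 3 * u ^ 2 / 2) / u ^ 2) : ℝ) : ℂ) →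
      ‖w‖ ≤ (3 * |x| + 3 * |z|) * (1 - (1 + u)) := by
    rintro _ rfl
    rw [norm_mul, Complex.norm_I, one_mul, Complex.norm_real, Real.norm_eq_abs]
    refine (abs_sub _ _).trans ?_
    rw [abs_mul, abs_mul]
    nlinarith [mul_le_mul_of_nonneg_left hx (abs_nonneg x),
      mul_le_mul_of_nonneg_left hz (abs_nonneg z)]
  apply key
  push_cast
  rw [add_sub_cancel_left]
  field_simp
  ring
end

section
/- Let x, z ∈ ℝ and y < 0 (so y + iz ≠ 0). Then Φ(τ,x,y,z) tends to 1/(2(y+iz)) as τ → 1⁻ with rate O(1-τ): there exist C ≥ 0 and δ ∈ (0,1) such that |Φ(τ,x,y,z) - 1/(2(y+iz))| ≤ C·(1-τ) for all τ ∈ (1-δ, 1). -/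
open MeasureTheory Set

noncomputable def radial (θ : ℝ) : ℝ := Real.sqrt (2 * θ ^ 2 - 2 * θ + 1)

noncomputable def radialDeriv (θ : ℝ) : ℝ := (2 * θ - 1) / radial θ

lemma radial_sq (θ : ℝ) : radial θ ^ 2 = 2 * θ ^ 2 - 2 * θ + 1 :=
  Real.sq_sqrt (by nlinarith [sq_nonneg (θ - 1 / 2)])

lemma half_le_radial (θ : ℝ) : 1 / 2 ≤ radial θ :=
  Real.le_sqrt_of_sq_le (by nlinarith [sq_nonneg (θ - 1 / 2)])

lemma radial_le_one {θ : ℝ} (h0 : 0 ≤ θ) (h1 : θ ≤ 1) : radial θ ≤ 1 := by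
  nlinarith [radial_sq θ, half_le_radial θ, mul_nonneg h0 (sub_nonneg.2 h1)]

lemma hasDerivAt_radial (θ : ℝ) : HasDerivAt radial (radialDeriv θ) θ := by
  have hpos : 2 * θ ^ 2 - 2 * θ + 1 ≠ 0 := by nlinarith [sq_nonneg (θ - 1 / 2)]
  have hp : HasDerivAt (fun t : ℝ => 2 * t ^ 2 - 2 * t + 1) (4 * θ - 2) θ := by
    refine (((((hasDerivAt_id' θ).pow 2).const_mul 2).sub
      ((hasDerivAt_id' θ).const_mul 2)).add_const (1 : ℝ)).congr_deriv ?_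
    simp
    ring
  refine (hp.sqrt hpos).congr_deriv ?_
  unfold radialDeriv radial
  have : Real.sqrt (2 * θ ^ 2 - 2 * θ + 1) ≠ 0 := by
    have := half_le_radial θ
    unfold radial at this
    positivity
  field_simp
  ring

lemma abs_radialDeriv_le {θ : ℝ} (h0 : 0 ≤ θ) (h1 : θ ≤ 1) : |radialDeriv θ| ≤ 2 := by
  have hr := half_le_radial θ
  unfold radialDeriv
  rw [abs_div, abs_of_pos (by linarith : 0 < radial θ), div_le_iff₀ (by linarith), abs_le]
  constructor <;> linarith

lemma abs_mul_radial_sub_one_le {θ : ℝ} (h0 : 0 ≤ θ) (h1 : θ ≤ 1) :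
    |θ * radial θ - 1| ≤ 3 * (1 - θ) := by
  have hr := half_le_radial θ
  have hr1 := radial_le_one h0 h1
  have hs := radial_sq θ
  have key : 1 - radial θ ≤ 2 * (1 - θ) := by nlinarith
  rw [abs_le]
  constructor <;> nlinarith

/-- The real part of `-wLam`. -/
noncomputable def wDecay (y θ : ℝ) : ℝ := y / (1 - θ) ^ 2 - 2 * y / (1 - θ)

noncomputable def wLamNegDeriv (θ x y z : ℝ) : ℂ :=
  2 * ((y : ℂ) + Complex.I * z * (θ * radial θ)) / (1 - θ) ^ 3
    + (Complex.I * z * (radial θ + θ * radialDeriv θ)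
      - (2 * y - Complex.I * x * radial θ)) / (1 - θ) ^ 2
    + Complex.I * x * radialDeriv θ / (1 - θ)

lemma neg_wLam_eq {θ : ℝ} (x y z : ℝ) :
    -wLam θ x y z = ((y : ℂ) + Complex.I * z * (θ * radial θ)) / (1 - θ) ^ 2
      - (2 * y - Complex.I * x * radial θ) / (1 - θ) := by
  have h1 : ((θ : ℂ) - 1)⁻¹ = -(1 - (θ : ℂ))⁻¹ := by rw [← inv_neg, neg_sub]
  have h2 : (((θ : ℂ) - 1) ^ 2) = (1 - (θ : ℂ)) ^ 2 := by ring
  unfold wLam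
  rw [h1, h2]
  change -(-((1 - (θ : ℂ)) ^ 2)⁻¹ * (y + Complex.I * z * ((θ * radial θ : ℝ) : ℂ))
    - -(1 - (θ : ℂ))⁻¹ * (2 * y - Complex.I * x * (radial θ : ℂ))) = _
  push_cast
  ring

lemma norm_exp_neg_wLam (θ x y z : ℝ) :
    ‖Complex.exp (-wLam θ x y z)‖ = Real.exp (wDecay y θ) := by
  rw [Complex.norm_exp, neg_wLam_eq]
  have : ((y : ℂ) + Complex.I * z * (θ * radial θ)) / (1 - θ) ^ 2
      - (2 * y - Complex.I * x * radial θ) / (1 - θ)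
      = ((wDecay y θ : ℝ) : ℂ)
        + ((z * (θ * radial θ) / (1 - θ) ^ 2 + x * radial θ / (1 - θ) : ℝ) : ℂ) * Complex.I := by
    unfold wDecay
    push_cast
    ring
  rw [this, Complex.add_re, Complex.ofReal_re, Complex.re_ofReal_mul, Complex.I_re, mul_zero,
    add_zero]

lemma hasDerivAt_neg_wLam {θ : ℝ} (hθ : θ < 1) (x y z : ℝ) :
    HasDerivAt (fun t : ℝ => -wLam t x y z) (wLamNegDeriv θ x y z) θ := by
  simp only [neg_wLam_eq]
  have hs : (1 - (θ : ℂ)) ≠ 0 := by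
    exact_mod_cast (by linarith : (1 - θ) ≠ 0)
  have ht : HasDerivAt (fun t : ℝ => (t : ℂ)) 1 θ := by
    simpa using (hasDerivAt_id θ).ofReal_comp
  have hr := (hasDerivAt_radial θ).ofReal_comp
  have h1 := ht.const_sub (1 : ℂ)
  have := ((((ht.mul hr).const_mul (Complex.I * z)).const_add (y : ℂ)).div (h1.pow 2)
    (pow_ne_zero 2 hs)).sub (((hr.const_mul (Complex.I * x)).const_sub (2 * (y : ℂ))).div h1 hs)
  refine this.congr_deriv ?_
  unfold wLamNegDeriv
  simp
  field_simp
  ring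

lemma hasDerivAt_wDecay {θ : ℝ} (hθ : θ < 1) (y : ℝ) :
    HasDerivAt (wDecay y) (2 * y * θ / (1 - θ) ^ 3) θ := by
  have hs : 1 - θ ≠ 0 := by linarith
  have h1 := (hasDerivAt_id θ).const_sub (1 : ℝ)
  have := ((hasDerivAt_const θ y).div (h1.pow 2) (pow_ne_zero 2 hs)).sub
    ((hasDerivAt_const θ (2 * y)).div h1 hs)
  refine this.congr_deriv ?_
  simp
  field_simp
  ring

lemma wDecay_nonpos {y θ : ℝ} (hy : y ≤ 0) (h0 : 1 / 2 ≤ θ) (h1 : θ ≤ 1) :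
    wDecay y θ ≤ 0 := by
  rcases h1.eq_or_lt with rfl | h1
  · simp [wDecay]
  · have hs : 0 < 1 - θ := by linarith
    have : wDecay y θ = y * (2 * θ - 1) / (1 - θ) ^ 2 := by
      unfold wDecay
      field_simp
      ring
    rw [this]
    exact div_nonpos_of_nonpos_of_nonneg
      (mul_nonpos_of_nonpos_of_nonneg hy (by linarith)) (by positivity)

lemma hasDerivAt_pow_mul_exp_wDecay {θ : ℝ} (hθ : θ < 1) (y : ℝ) (n : ℕ) :
    HasDerivAt (fun t => -((1 - t) ^ (n + 1) * Real.exp (wDecay y t)))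
      (Real.exp (wDecay y θ) * ((n + 1) * (1 - θ) ^ n - 2 * y * θ * (1 - θ) ^ (n + 1) / (1 - θ) ^ 3)) θ := by
  have h1 := (((hasDerivAt_id θ).const_sub (1 : ℝ)).pow (n + 1)).mul (hasDerivAt_wDecay hθ y).exp
  refine h1.neg.congr_deriv ?_
  simp
  ring

lemma continuousOn_smul_of_norm_le_one {E : Type*} [NormedAddCommGroup E] [NormedSpace ℝ E]
    {f : ℝ → E} {τ : ℝ} (n : ℕ) (hf : ∀ t ∈ Ico τ 1, ContinuousAt f t)
    (hb : ∀ t ∈ Icc τ 1, ‖f t‖ ≤ 1) :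
    ContinuousOn (fun t => (1 - t) ^ (n + 1) • f t) (Icc τ 1) := by
  intro t ht
  rcases ht.2.eq_or_lt with rfl | h1
  · have hz : Filter.Tendsto (fun t : ℝ => (1 - t) ^ (n + 1)) (nhdsWithin 1 (Icc τ 1)) (nhds 0) := by
      have : Continuous (fun t : ℝ => (1 - t) ^ (n + 1)) := by fun_prop
      simpa using (this.tendsto 1).mono_left nhdsWithin_le_nhds
    have : Filter.Tendsto (fun t => (1 - t) ^ (n + 1) • f t) (nhdsWithin 1 (Icc τ 1)) (nhds 0) := by
      have hz' := hz.norm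
      rw [norm_zero] at hz'
      refine squeeze_zero_norm' ?_ hz'
      filter_upwards [self_mem_nhdsWithin] with t ht
      rw [norm_smul]
      exact mul_le_of_le_one_right (norm_nonneg _) (hb t ht)
    simpa [ContinuousWithinAt] using this
  · have hc : ContinuousAt (fun t : ℝ => (1 - t) ^ (n + 1)) t := by fun_prop
    exact (hc.smul (hf t ⟨ht.1, h1⟩)).continuousWithinAt

/-- The difference between the derivative of `(1 - θ) exp (-wLam θ) / (2 (y + i z))` and
`exp (-wLam θ) / (θ - 1) ^ 2`, divided by `exp (-wLam θ)`. -/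
noncomputable def wRemainder (θ x y z : ℝ) : ℂ :=
  (2 * (Complex.I * z * (θ * radial θ - 1)) / (1 - θ) ^ 2
    + (Complex.I * z * (radial θ + θ * radialDeriv θ)
      - (2 * y - Complex.I * x * radial θ)) / (1 - θ)
    + Complex.I * x * radialDeriv θ - 1) / (2 * ((y : ℂ) + Complex.I * z))

lemma hasDerivAt_primitive {θ : ℝ} (hθ : θ < 1) (x y z : ℝ) (hw : (y : ℂ) + Complex.I * z ≠ 0) :
    HasDerivAt (fun t : ℝ => (1 - t) ^ (0 + 1) •
        (Complex.exp (-wLam t x y z) / (2 * ((y : ℂ) + Complex.I * z))))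
      (Complex.exp (-wLam θ x y z) / ((θ : ℂ) - 1) ^ 2
        + Complex.exp (-wLam θ x y z) * wRemainder θ x y z) θ := by
  have hs : (1 - (θ : ℂ)) ≠ 0 := by
    exact_mod_cast (by linarith : (1 - θ) ≠ 0)
  have ht : HasDerivAt (fun t : ℝ => (t : ℂ)) 1 θ := by
    simpa using (hasDerivAt_id θ).ofReal_comp
  have h := (ht.const_sub 1).mul
    (((hasDerivAt_neg_wLam hθ x y z).cexp).div_const (2 * ((y : ℂ) + Complex.I * z)))
  convert! h using 1
  · ext t
    simp [Complex.real_smul]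
  · rw [show ((θ : ℂ) - 1) ^ 2 = (1 - θ) ^ 2 by ring]
    unfold wRemainder wLamNegDeriv
    field_simp
    ring

lemma norm_wRemainder_le {θ : ℝ} (h0 : 0 ≤ θ) (h1 : θ < 1) (x y z : ℝ) :
    ‖wRemainder θ x y z‖ ≤
      (9 * |z| + 2 * |y| + 3 * |x| + 1) / (2 * ‖(y : ℂ) + Complex.I * z‖) / (1 - θ) := by
  have hs : 0 < 1 - θ := by linarith
  have hr := half_le_radial θ
  have hr1 := radial_le_one h0 h1.le
  have hd := abs_radialDeriv_le h0 h1.le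
  have hm := abs_mul_radial_sub_one_le h0 h1.le
  have hra : |radial θ| ≤ 1 := by rw [abs_of_pos (by linarith)]; exact hr1
  have htd : |radial θ + θ * radialDeriv θ| ≤ 3 := by
    refine (abs_add_le _ _).trans ?_
    rw [abs_mul, abs_of_nonneg h0]
    nlinarith [abs_nonneg (radialDeriv θ)]
  have hterm : ∀ a b : ℝ, ∀ c, |b| ≤ c → ‖Complex.I * (a : ℂ) * (b : ℂ)‖ ≤ |a| * c := by
    intro a b c h
    rw [norm_mul, norm_mul, Complex.norm_I, Complex.norm_real, Complex.norm_real, one_mul]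
    exact mul_le_mul_of_nonneg_left h (abs_nonneg a)
  have e1 := hterm z _ _ hm
  have e2 := hterm z _ _ htd
  have e3 := hterm x _ _ hra
  have e4 := hterm x _ _ hd
  have hy2 : ‖2 * (y : ℂ)‖ = 2 * |y| := by simp
  have hsn : ‖((1 - θ : ℝ) : ℂ)‖ = 1 - θ := by
    rw [Complex.norm_real, Real.norm_of_nonneg hs.le]
  have hform : wRemainder θ x y z =
      (2 * (Complex.I * z * ((θ * radial θ - 1 : ℝ) : ℂ)) / ((1 - θ : ℝ) : ℂ) ^ 2
        + (Complex.I * z * ((radial θ + θ * radialDeriv θ : ℝ) : ℂ)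
          - (2 * y - Complex.I * x * radial θ)) / ((1 - θ : ℝ) : ℂ)
        + Complex.I * x * radialDeriv θ - 1) / (2 * ((y : ℂ) + Complex.I * z)) := by
    unfold wRemainder
    push_cast
    rfl
  rw [hform, norm_div, norm_mul, Complex.norm_two, div_right_comm _ _ (1 - θ)]
  gcongr
  have f1 : ‖2 * (Complex.I * z * ((θ * radial θ - 1 : ℝ) : ℂ)) / ((1 - θ : ℝ) : ℂ) ^ 2‖
      ≤ 6 * |z| / (1 - θ) := by
    rw [norm_div, norm_pow, hsn, norm_mul, Complex.norm_two, div_le_div_iff₀ (by positivity) hs]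
    nlinarith
  have f2 : ‖(Complex.I * z * ((radial θ + θ * radialDeriv θ : ℝ) : ℂ)
      - (2 * y - Complex.I * x * radial θ)) / ((1 - θ : ℝ) : ℂ)‖
      ≤ (3 * |z| + 2 * |y| + |x|) / (1 - θ) := by
    rw [norm_div, hsn]
    gcongr
    refine (norm_sub_le _ _).trans ?_
    linarith [norm_sub_le (2 * (y : ℂ)) (Complex.I * x * radial θ)]
  have f3 : 2 * |x| + 1 ≤ (2 * |x| + 1) / (1 - θ) := by
    rw [le_div_iff₀ hs]
    nlinarith [abs_nonneg x]
  have hsum : (9 * |z| + 2 * |y| + 3 * |x| + 1) / (1 - θ) = 6 * |z| / (1 - θ)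
      + (3 * |z| + 2 * |y| + |x|) / (1 - θ) + (2 * |x| + 1) / (1 - θ) := by
    ring
  rw [hsum]
  refine (norm_sub_le _ _).trans ?_
  rw [norm_one]
  refine (add_le_add_left (norm_add₃_le) _).trans ?_
  linarith

lemma continuousOn_pow_mul_exp_wDecay {y τ : ℝ} (hy : y < 0) (h0 : 1 / 2 ≤ τ) (n : ℕ) :
    ContinuousOn (fun t => -((1 - t) ^ (n + 1) * Real.exp (wDecay y t))) (Icc τ 1) := by
  refine (continuousOn_smul_of_norm_le_one (f := fun t => Real.exp (wDecay y t)) n ?_ ?_).neg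
  · exact fun t ht => (hasDerivAt_wDecay ht.2 y).exp.continuousAt
  · intro t ht
    rw [Real.norm_of_nonneg (Real.exp_pos _).le, Real.exp_le_one_iff]
    exact wDecay_nonpos hy.le (h0.trans ht.1) ht.2

lemma deriv_pow_mul_exp_wDecay_ge {y θ : ℝ} (hy : y < 0) (h0 : 1 / 2 ≤ θ) (h1 : θ < 1) (n : ℕ) :
    |y| * (Real.exp (wDecay y θ) * ((1 - θ) ^ (n + 1) / (1 - θ) ^ 3)) ≤
      Real.exp (wDecay y θ) *
        ((n + 1) * (1 - θ) ^ n - 2 * y * θ * (1 - θ) ^ (n + 1) / (1 - θ) ^ 3) := by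
  have hs : 0 < 1 - θ := by linarith
  have hq : 0 < (1 - θ) ^ (n + 1) / (1 - θ) ^ 3 := by positivity
  have hn : 0 ≤ ((n : ℝ) + 1) * (1 - θ) ^ n := by positivity
  rw [abs_of_neg hy, mul_left_comm]
  refine mul_le_mul_of_nonneg_left ?_ (Real.exp_pos _).le
  rw [mul_div_assoc]
  nlinarith [mul_nonneg (mul_nonneg (neg_nonneg.2 hy.le) (by linarith : 0 ≤ 2 * θ - 1)) hq.le]

lemma intervalIntegrable_deriv_pow_mul_exp_wDecay {y τ : ℝ} (hy : y < 0) (h0 : 1 / 2 ≤ τ)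
    (h1 : τ < 1) (n : ℕ) :
    IntervalIntegrable (fun θ => Real.exp (wDecay y θ) *
      ((n + 1) * (1 - θ) ^ n - 2 * y * θ * (1 - θ) ^ (n + 1) / (1 - θ) ^ 3)) volume τ 1 := by
  rw [intervalIntegrable_iff_integrableOn_Ioc_of_le h1.le]
  refine intervalIntegral.integrableOn_deriv_of_nonneg (continuousOn_pow_mul_exp_wDecay hy h0 n)
    (fun θ hθ => hasDerivAt_pow_mul_exp_wDecay hθ.2 y n) (fun θ hθ => ?_)
  refine le_trans ?_ (deriv_pow_mul_exp_wDecay_ge hy (h0.trans hθ.1.le) hθ.2 n)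
  have : 0 < 1 - θ := by linarith [hθ.2]
  positivity

lemma measurable_exp_wDecay (y : ℝ) : Measurable (fun θ => Real.exp (wDecay y θ)) := by
  unfold wDecay
  fun_prop

lemma intervalIntegrable_exp_wDecay_mul {y τ : ℝ} (hy : y < 0) (h0 : 1 / 2 ≤ τ) (h1 : τ < 1)
    (n : ℕ) :
    IntervalIntegrable (fun θ => Real.exp (wDecay y θ) * ((1 - θ) ^ (n + 1) / (1 - θ) ^ 3))
      volume τ 1 := by
  refine ((intervalIntegrable_deriv_pow_mul_exp_wDecay hy h0 h1 n).const_mul |y|⁻¹).mono_fun'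
    ((measurable_exp_wDecay y).mul (by fun_prop)).aestronglyMeasurable ?_
  rw [uIoc_of_le h1.le, ← restrict_Ioo_eq_restrict_Ioc]
  filter_upwards [ae_restrict_mem measurableSet_Ioo] with θ hθ
  have hs : 0 < 1 - θ := by linarith [hθ.2]
  rw [Real.norm_of_nonneg (by positivity), le_inv_mul_iff₀ (abs_pos.2 hy.ne)]
  exact deriv_pow_mul_exp_wDecay_ge hy (h0.trans hθ.1.le) hθ.2 n

lemma integral_exp_wDecay_mul_le {y τ : ℝ} (hy : y < 0) (h0 : 1 / 2 ≤ τ) (h1 : τ < 1) (n : ℕ) :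
    ∫ θ in τ..1, Real.exp (wDecay y θ) * ((1 - θ) ^ (n + 1) / (1 - θ) ^ 3)
      ≤ |y|⁻¹ * ((1 - τ) ^ (n + 1) * Real.exp (wDecay y τ)) := by
  have hint := intervalIntegrable_deriv_pow_mul_exp_wDecay hy h0 h1 n
  have heq := intervalIntegral.integral_eq_sub_of_hasDerivAt_of_le h1.le
    (continuousOn_pow_mul_exp_wDecay hy h0 n)
    (fun θ hθ => hasDerivAt_pow_mul_exp_wDecay hθ.2 y n) hint
  have hle := intervalIntegral.integral_mono_on_of_le_Ioo h1.le
    ((intervalIntegrable_exp_wDecay_mul hy h0 h1 n).const_mul |y|) hint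
    (fun θ hθ => deriv_pow_mul_exp_wDecay_ge hy (h0.trans hθ.1.le) hθ.2 n)
  rw [intervalIntegral.integral_const_mul, heq] at hle
  rw [le_inv_mul_iff₀ (abs_pos.2 hy.ne)]
  simpa using hle

lemma measurable_exp_neg_wLam (x y z : ℝ) :
    Measurable (fun θ => Complex.exp (-wLam θ x y z)) := by
  unfold wLam
  fun_prop

lemma measurable_radial : Measurable radial := by
  unfold radial
  fun_prop

lemma measurable_wRemainder (x y z : ℝ) : Measurable (fun θ => wRemainder θ x y z) := by
  have hr := measurable_radial
  have hd : Measurable radialDeriv := by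
    unfold radialDeriv
    fun_prop
  unfold wRemainder
  fun_prop

lemma intervalIntegrable_exp_neg_wLam_div_sq {y τ : ℝ} (x z : ℝ) (hy : y < 0) (h0 : 1 / 2 ≤ τ)
    (h1 : τ < 1) :
    IntervalIntegrable (fun θ => Complex.exp (-wLam θ x y z) / ((θ : ℂ) - 1) ^ 2) volume τ 1 := by
  refine (intervalIntegrable_exp_wDecay_mul hy h0 h1 0).mono_fun'
    ((measurable_exp_neg_wLam x y z).div (by fun_prop)).aestronglyMeasurable ?_
  rw [uIoc_of_le h1.le, ← restrict_Ioo_eq_restrict_Ioc]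
  filter_upwards [ae_restrict_mem measurableSet_Ioo] with θ hθ
  have hs : 0 < 1 - θ := by linarith [hθ.2]
  have hn : ‖(θ : ℂ) - 1‖ = 1 - θ := by
    rw [norm_sub_rev, ← Complex.ofReal_one, ← Complex.ofReal_sub, Complex.norm_real,
      Real.norm_of_nonneg hs.le]
  rw [norm_div, norm_pow, hn, norm_exp_neg_wLam]
  apply le_of_eq
  field_simp
  ring

lemma norm_exp_mul_wRemainder_le {θ : ℝ} (h0 : 0 ≤ θ) (h1 : θ < 1) (x y z : ℝ) :
    ‖Complex.exp (-wLam θ x y z) * wRemainder θ x y z‖ ≤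
      (9 * |z| + 2 * |y| + 3 * |x| + 1) / (2 * ‖(y : ℂ) + Complex.I * z‖) *
        (Real.exp (wDecay y θ) * ((1 - θ) ^ (1 + 1) / (1 - θ) ^ 3)) := by
  have hs : 0 < 1 - θ := by linarith
  rw [norm_mul, norm_exp_neg_wLam]
  refine (mul_le_mul_of_nonneg_left (norm_wRemainder_le h0 h1 x y z)
    (Real.exp_pos _).le).trans_eq ?_
  have : (1 - θ) ^ (1 + 1) / (1 - θ) ^ 3 = (1 - θ)⁻¹ := by field_simp
  rw [this]
  ring

lemma norm_integral_add_primitive_le {y τ : ℝ} (x z : ℝ) (hy : y < 0) (h0 : 1 / 2 ≤ τ)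
    (h1 : τ < 1) :
    ‖(∫ θ in τ..1, Complex.exp (-(wLam θ x y z)) / ((θ : ℂ) - 1) ^ 2)
        + (1 - τ) * (Complex.exp (-wLam τ x y z) / (2 * ((y : ℂ) + Complex.I * z)))‖ ≤
      (9 * |z| + 2 * |y| + 3 * |x| + 1) / (2 * ‖(y : ℂ) + Complex.I * z‖) * |y|⁻¹ *
        ((1 - τ) ^ 2 * Real.exp (wDecay y τ)) := by
  set w : ℂ := (y : ℂ) + Complex.I * z with hwdef
  set K : ℝ := (9 * |z| + 2 * |y| + 3 * |x| + 1) / (2 * ‖w‖) with hK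
  have hK0 : 0 ≤ K := by positivity
  have hw : w ≠ 0 := by
    intro h
    have := congrArg Complex.re h
    simp [hwdef] at this
    exact hy.ne this
  have hdom := (intervalIntegrable_exp_wDecay_mul hy h0 h1 1).const_mul K
  have hbound : ∀ θ ∈ Ioo τ 1, ‖Complex.exp (-wLam θ x y z) * wRemainder θ x y z‖ ≤
      K * (Real.exp (wDecay y θ) * ((1 - θ) ^ (1 + 1) / (1 - θ) ^ 3)) :=
    fun θ hθ => norm_exp_mul_wRemainder_le (by linarith [hθ.1]) hθ.2 x y z
  have hae : ∀ᵐ θ, θ ∈ Ioc τ 1 → ‖Complex.exp (-wLam θ x y z) * wRemainder θ x y z‖ ≤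
      K * (Real.exp (wDecay y θ) * ((1 - θ) ^ (1 + 1) / (1 - θ) ^ 3)) := by
    rw [← ae_restrict_iff' measurableSet_Ioc, ← restrict_Ioo_eq_restrict_Ioc]
    filter_upwards [ae_restrict_mem measurableSet_Ioo] with θ hθ using hbound θ hθ
  have hI := intervalIntegrable_exp_neg_wLam_div_sq x z hy h0 h1
  have hE : IntervalIntegrable (fun θ => Complex.exp (-wLam θ x y z) * wRemainder θ x y z)
      volume τ 1 := by
    refine hdom.mono_fun' ((measurable_exp_neg_wLam x y z).mul
      (measurable_wRemainder x y z)).aestronglyMeasurable ?_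
    rw [uIoc_of_le h1.le]
    exact (ae_restrict_iff' measurableSet_Ioc).2 hae
  have hcont : ContinuousOn (fun t : ℝ => (1 - t) ^ (0 + 1) •
      (Complex.exp (-wLam t x y z) / (2 * w))) (Icc τ 1) := by
    have := (continuousOn_smul_of_norm_le_one (f := fun t => Complex.exp (-wLam t x y z))
      (τ := τ) 0 (fun t ht => (hasDerivAt_neg_wLam ht.2 x y z).cexp.continuousAt) (fun t ht => by
        rw [norm_exp_neg_wLam, Real.exp_le_one_iff]
        exact wDecay_nonpos hy.le (h0.trans ht.1) ht.2)).div_const (2 * w)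
    simpa only [smul_div_assoc] using this
  have hftc := intervalIntegral.integral_eq_sub_of_hasDerivAt_of_le h1.le hcont
    (fun θ hθ => hasDerivAt_primitive hθ.2 x y z hw) (hI.add hE)
  rw [intervalIntegral.integral_add hI hE] at hftc
  have hval : (∫ θ in τ..1, Complex.exp (-(wLam θ x y z)) / ((θ : ℂ) - 1) ^ 2)
        + (1 - τ) * (Complex.exp (-wLam τ x y z) / (2 * w))
      = -∫ θ in τ..1, Complex.exp (-wLam θ x y z) * wRemainder θ x y z := by
    simp only [zero_add, pow_one, sub_self, zero_smul, zero_sub, Complex.real_smul,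
      Complex.ofReal_sub, Complex.ofReal_one] at hftc
    linear_combination hftc
  rw [hval, norm_neg]
  refine (intervalIntegral.norm_integral_le_of_norm_le h1.le hae hdom).trans ?_
  rw [intervalIntegral.integral_const_mul, mul_assoc]
  exact mul_le_mul_of_nonneg_left (integral_exp_wDecay_mul_le hy h0 h1 1) hK0

/-- Boundary behaviour of the bounded solution of the Levin ODE: for `y < 0`,
`Φ(τ,x,y,z) → 1/(2(y+iz))` as `τ → 1⁻`, with rate `O(1-τ)`. -/
theorem wPhi_limit_at_one (x y z : ℝ) (hy : y < 0) :
    ∃ C : ℝ, 0 ≤ C ∧ ∃ δ ∈ Set.Ioo (0 : ℝ) 1, ∀ τ ∈ Set.Ioo (1 - δ) 1,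
      ‖wPhi τ x y z - 1 / (2 * ((y : ℂ) + Complex.I * (z : ℂ)))‖ ≤ C * (1 - τ) := by
  refine ⟨(9 * |z| + 2 * |y| + 3 * |x| + 1) / (2 * ‖(y : ℂ) + Complex.I * z‖) * |y|⁻¹,
    by positivity, 1 / 2, by norm_num, fun τ hτ => ?_⟩
  have h1 : τ < 1 := hτ.2
  have h0 : 1 / 2 ≤ τ := by linarith [hτ.1]
  have hs : 0 < 1 - τ := by linarith
  have hsc : (τ : ℂ) - 1 ≠ 0 := by
    exact_mod_cast (by linarith : τ - 1 ≠ 0)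
  have hn : ‖(τ : ℂ) - 1‖ = 1 - τ := by
    rw [norm_sub_rev, ← Complex.ofReal_one, ← Complex.ofReal_sub, Complex.norm_real,
      Real.norm_of_nonneg hs.le]
  have hmain := norm_integral_add_primitive_le x z hy h0 h1
  have hexp : Complex.exp (wLam τ x y z) * Complex.exp (-wLam τ x y z) = 1 := by
    rw [← Complex.exp_add, add_neg_cancel, Complex.exp_zero]
  have hdecomp : wPhi τ x y z - 1 / (2 * ((y : ℂ) + Complex.I * (z : ℂ))) =
      Complex.exp (wLam τ x y z) / ((τ : ℂ) - 1) *
        ((∫ θ in τ..1, Complex.exp (-(wLam θ x y z)) / ((θ : ℂ) - 1) ^ 2)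
          + (1 - τ) * (Complex.exp (-wLam τ x y z) / (2 * ((y : ℂ) + Complex.I * z)))) := by
    have hcancel : Complex.exp (wLam τ x y z) / ((τ : ℂ) - 1) *
        ((1 - τ) * (Complex.exp (-wLam τ x y z) / (2 * ((y : ℂ) + Complex.I * z))))
        = -(1 / (2 * ((y : ℂ) + Complex.I * z))) := by
      calc _ = -(((τ : ℂ) - 1) / ((τ : ℂ) - 1)) * (Complex.exp (wLam τ x y z) *
            Complex.exp (-wLam τ x y z)) / (2 * ((y : ℂ) + Complex.I * z)) := by ring
        _ = _ := by rw [hexp, div_self hsc]; ring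
    rw [mul_add (Complex.exp _ / _), hcancel, wPhi, sub_eq_add_neg]
  have hnexp : ‖Complex.exp (wLam τ x y z)‖ * Real.exp (wDecay y τ) = 1 := by
    rw [← norm_exp_neg_wLam τ x y z, ← norm_mul, hexp, norm_one]
  rw [hdecomp, norm_mul, norm_div, hn]
  refine (mul_le_mul_of_nonneg_left hmain (by positivity)).trans_eq ?_
  generalize (9 * |z| + 2 * |y| + 3 * |x| + 1) / (2 * ‖(y : ℂ) + Complex.I * z‖) * |y|⁻¹ = K
  calc _ = K * ((1 - τ) ^ 2 / (1 - τ)) *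
        (‖Complex.exp (wLam τ x y z)‖ * Real.exp (wDecay y τ)) := by ring
    _ = _ := by rw [hnexp, mul_one, sq, mul_self_div_self]
end

section
/- Let x, z ∈ ℝ and y < 0. Then the wavelike integral is expressed through the bounded solution of the Levin ODE evaluated at 0: ∫₀^∞ e^{ϖ(t,x,y,z)} dt = -e^{y+ix} · Φ(0,x,y,z). -/
open MeasureTheory Set

noncomputable def wPhase (t x y z : ℝ) : ℂ :=
  (y * (1 + t ^ 2) : ℝ) + Complex.I * ((x + z * t : ℝ) : ℂ) * ((Real.sqrt (1 + t ^ 2) : ℝ) : ℂ)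

lemma image_div_one_sub_Ioo :
    (fun θ : ℝ => θ / (1 - θ)) '' Ioo 0 1 = Ioi 0 := by
  ext t
  simp only [mem_image, mem_Ioo, mem_Ioi]
  constructor
  · rintro ⟨θ, ⟨h0, h1⟩, rfl⟩
    exact div_pos h0 (sub_pos.2 h1)
  · intro ht
    have h : 0 < 1 + t := by linarith
    refine ⟨t / (1 + t), ⟨div_pos ht h, (div_lt_one h).2 (by linarith)⟩, ?_⟩
    have e : 1 - t / (1 + t) = 1 / (1 + t) := by field_simp; ring
    rw [e]
    field_simp

lemma injOn_div_one_sub_Ioo : InjOn (fun θ : ℝ => θ / (1 - θ)) (Ioo 0 1) := by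
  intro a ha b hb h
  have h1 : 1 - a ≠ 0 := (sub_pos.2 ha.2).ne'
  have h2 : 1 - b ≠ 0 := (sub_pos.2 hb.2).ne'
  have h3 := (div_eq_div_iff h1 h2).1 h
  linarith

lemma hasDerivAt_div_one_sub {θ : ℝ} (h : θ < 1) :
    HasDerivAt (fun θ : ℝ => θ / (1 - θ)) (((1 - θ) ^ 2)⁻¹) θ := by
  have h1 : 1 - θ ≠ 0 := (sub_pos.2 h).ne'
  have h2 := (hasDerivAt_id' θ).fun_div ((hasDerivAt_id' θ).const_sub 1) h1
  exact h2.congr_deriv (by field_simp; ring)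

/-- Under `t = θ / (1 - θ)`, the phase becomes `2 y - Λ(θ)`. -/
lemma wPhase_div_one_sub (x y z : ℝ) {θ : ℝ} (h : θ < 1) :
    wPhase (θ / (1 - θ)) x y z = 2 * (y : ℂ) + -wLam θ x y z := by
  have h0 : 0 < 1 - θ := sub_pos.2 h
  have hc : (1 : ℂ) - θ ≠ 0 := by exact_mod_cast h0.ne'
  have hc' : (θ : ℂ) - 1 ≠ 0 := by
    rw [← neg_sub]
    exact neg_ne_zero.2 hc
  have hs : 1 + (θ / (1 - θ)) ^ 2 = (2 * θ ^ 2 - 2 * θ + 1) / (1 - θ) ^ 2 := by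
    field_simp
    ring
  have hinv : ((θ : ℂ) - 1)⁻¹ = -(1 - (θ : ℂ))⁻¹ := by
    rw [← neg_sub, inv_neg]
  rw [wPhase, wLam, hs, Real.sqrt_div' _ (sq_nonneg _), Real.sqrt_sq h0.le, ← inv_pow, hinv]
  push_cast
  field_simp
  ring

/-- The wavelike integral expressed through the bounded solution of the Levin ODE:
for `y < 0`, `∫₀^∞ e^{ϖ(t,x,y,z)} dt = -e^{y+ix} Φ(0,x,y,z)`. -/
theorem wavelike_integral_via_wPhi (x y z : ℝ) (hy : y < 0) :
    ∫ t in Set.Ioi (0 : ℝ), Complex.exp (wPhase t x y z) =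
      -Complex.exp ((y : ℂ) + Complex.I * (x : ℂ)) * wPhi 0 x y z := by
  have hprod : Complex.exp ((y : ℂ) + Complex.I * (x : ℂ)) * Complex.exp (wLam 0 x y z) =
      Complex.exp (2 * (y : ℂ)) := by
    rw [← Complex.exp_add]
    congr 1
    simp [wLam]
    ring
  have hrhs : -Complex.exp ((y : ℂ) + Complex.I * (x : ℂ)) * wPhi 0 x y z =
      Complex.exp (2 * (y : ℂ)) *
        ∫ θ in Ioo (0 : ℝ) 1, Complex.exp (-(wLam θ x y z)) / ((θ : ℂ) - 1) ^ 2 := by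
    rw [wPhi, intervalIntegral.integral_of_le zero_le_one, integral_Ioc_eq_integral_Ioo, ← hprod]
    push_cast
    ring
  rw [hrhs, ← integral_const_mul, ← image_div_one_sub_Ioo,
    integral_image_eq_integral_abs_deriv_smul measurableSet_Ioo
      (fun θ hθ => (hasDerivAt_div_one_sub hθ.2).hasDerivWithinAt) injOn_div_one_sub_Ioo]
  refine setIntegral_congr_fun measurableSet_Ioo fun θ hθ => ?_
  simp only [wPhase_div_one_sub x y z hθ.2, Complex.exp_add, Complex.real_smul]
  rw [abs_of_nonneg (by positivity)]
  push_cast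
  rw [← neg_sub (θ : ℂ) 1, neg_sq]
  ring
end

section
/- Let x, z ∈ ℝ, y < 0, and let P : ℝ → ℂ be a polynomial. Define the residual r(τ) = (1-τ)³ P'(τ) + [σ(τ,x,y,z) - (1-τ)²] P(τ) - 1 for τ ∈ [0,1]. Then the error of the Levin-type approximation of the wavelike integral satisfies |∫₀^∞ e^{ϖ(t,x,y,z)} dt + e^{y+ix} P(0)| ≤ (√π/(2√(-y))) · e^{y} · max_{τ∈[0,1]} |r(τ)|. -/
open MeasureTheory Set

/-- The residual of the Levin-type collocation equation for `P`. -/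
noncomputable def levinResidual (x y z : ℝ) (P : Polynomial ℂ) (τ : ℝ) : ℂ :=
  (1 - (τ : ℂ)) ^ 3 * P.derivative.eval (τ : ℂ) +
    (wSigma τ x y z - (1 - (τ : ℂ)) ^ 2) * P.eval (τ : ℂ) - 1

/-- The derivative of `t ↦ wPhase t x y z`. -/
noncomputable def wPhaseDeriv (t x y z : ℝ) : ℂ :=
  (2 * y * t : ℝ) + Complex.I * ((x * t + z * (1 + 2 * t ^ 2) : ℝ) : ℂ) / (√(1 + t ^ 2) : ℝ)

theorem continuous_levinResidual (x y z : ℝ) (P : Polynomial ℂ) :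
    Continuous (levinResidual x y z P) := by
  have h0 (τ : ℝ) : √(2 * τ ^ 2 - 2 * τ + 1) ≠ 0 :=
    (Real.sqrt_pos.2 (by nlinarith [sq_nonneg (2 * τ - 1)])).ne'
  have hs : Continuous fun τ : ℝ => wSigma τ x y z := by
    unfold wSigma
    have h1 : Continuous fun τ : ℝ => τ * (1 - τ) / √(2 * τ ^ 2 - 2 * τ + 1) :=
      Continuous.div (by fun_prop) (by fun_prop) h0
    have h2 : Continuous fun τ : ℝ => (3 * τ ^ 2 - 2 * τ + 1) / √(2 * τ ^ 2 - 2 * τ + 1) :=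
      Continuous.div (by fun_prop) (by fun_prop) h0
    fun_prop
  have hP (Q : Polynomial ℂ) : Continuous fun τ : ℝ => Q.eval (τ : ℂ) :=
    Q.continuous.comp Complex.continuous_ofReal
  have := hP P
  have := hP P.derivative
  unfold levinResidual
  fun_prop

theorem norm_exp_wPhase (t x y z : ℝ) :
    ‖Complex.exp (wPhase t x y z)‖ = Real.exp y * Real.exp (-(-y) * t ^ 2) := by
  rw [Complex.norm_exp, ← Real.exp_add]
  congr 1
  simp only [wPhase, mul_assoc, ← Complex.ofReal_mul, Complex.add_re, Complex.ofReal_re,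
    Complex.I_mul_re, Complex.ofReal_im]
  ring

theorem hasDerivAt_wPhase (t x y z : ℝ) :
    HasDerivAt (fun t => wPhase t x y z) (wPhaseDeriv t x y z) t := by
  have hpos : 0 < 1 + t ^ 2 := by positivity
  have h1 : HasDerivAt (fun t : ℝ => 1 + t ^ 2) (2 * t) t := by
    simpa using (hasDerivAt_pow 2 t).const_add 1
  have h2 : HasDerivAt (fun t : ℝ => x + z * t) z t := by
    simpa using ((hasDerivAt_id t).const_mul z).const_add x
  have h3 := ((h2.mul (h1.sqrt hpos.ne')).ofReal_comp).const_mul Complex.I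
  have h4 := (h1.const_mul y).ofReal_comp.add h3
  refine (h4.congr_of_eventuallyEq (.of_forall fun t => ?_)).congr_deriv ?_
  · simp [wPhase, mul_assoc]
  · have h5 : z * √(1 + t ^ 2) + (x + z * t) * (2 * t / (2 * √(1 + t ^ 2))) =
        (x * t + z * (1 + 2 * t ^ 2)) / √(1 + t ^ 2) := by
      field_simp
      rw [Real.sq_sqrt hpos.le]
      ring
    rw [h5, wPhaseDeriv]
    push_cast
    ring

theorem wSigma_div_one_add {t : ℝ} (ht : 0 ≤ t) (x y z : ℝ) :
    wSigma (t / (1 + t)) x y z = (1 + t : ℂ)⁻¹ * wPhaseDeriv t x y z := by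
  have h1 : 0 < 1 + t := by positivity
  have hq : √(2 * (t / (1 + t)) ^ 2 - 2 * (t / (1 + t)) + 1) = √(1 + t ^ 2) / (1 + t) := by
    rw [show 2 * (t / (1 + t)) ^ 2 - 2 * (t / (1 + t)) + 1 = (1 + t ^ 2) / (1 + t) ^ 2 by
      field_simp; ring, Real.sqrt_div (by positivity), Real.sqrt_sq h1.le]
  have ha : t / (1 + t) * (1 - t / (1 + t)) / (√(1 + t ^ 2) / (1 + t)) =
      (1 + t)⁻¹ * (t / √(1 + t ^ 2)) := by
    field_simp; ring
  have hb : (3 * (t / (1 + t)) ^ 2 - 2 * (t / (1 + t)) + 1) / (√(1 + t ^ 2) / (1 + t)) =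
      (1 + t)⁻¹ * ((1 + 2 * t ^ 2) / √(1 + t ^ 2)) := by
    field_simp; ring
  rw [wSigma, hq, ha, hb, wPhaseDeriv]
  push_cast
  ring

/-- An antiderivative of `(r + 1) * exp ϖ`, with `r` the residual at `τ = t / (1 + t)`. -/
noncomputable def levinPrimitive (x y z : ℝ) (P : Polynomial ℂ) (t : ℝ) : ℂ :=
  (1 + t : ℂ)⁻¹ * P.eval ((t / (1 + t) : ℝ) : ℂ) * Complex.exp (wPhase t x y z)

theorem hasDerivAt_levinPrimitive {t : ℝ} (ht : 0 ≤ t) (x y z : ℝ) (P : Polynomial ℂ) :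
    HasDerivAt (levinPrimitive x y z P)
      ((levinResidual x y z P (t / (1 + t)) + 1) * Complex.exp (wPhase t x y z)) t := by
  have h1 : 1 + t ≠ 0 := by positivity
  have h1c : (1 + t : ℂ) ≠ 0 := by exact_mod_cast h1
  have hl : HasDerivAt (fun t : ℝ => 1 + t) 1 t := (hasDerivAt_id t).const_add 1
  have hi : HasDerivAt (fun t : ℝ => (1 + t : ℂ)⁻¹) (-(1 + t : ℂ)⁻¹ ^ 2) t := by
    refine ((hl.inv h1).ofReal_comp.congr_of_eventuallyEq (.of_forall fun t => ?_)).congr_deriv ?_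
    · simp
    · push_cast; field_simp
  have hτ : HasDerivAt (fun t : ℝ => ((t / (1 + t) : ℝ) : ℂ)) ((1 + t : ℂ)⁻¹ ^ 2) t := by
    refine ((hasDerivAt_id t).div hl h1).ofReal_comp.congr_deriv ?_
    simp
  have hP : HasDerivAt (fun t : ℝ => P.eval ((t / (1 + t) : ℝ) : ℂ)) _ t :=
    (P.hasDerivAt _).comp t hτ
  refine ((hi.mul hP).mul (hasDerivAt_wPhase t x y z).cexp).congr_deriv ?_
  have h2 : 1 - ((t / (1 + t) : ℝ) : ℂ) = (1 + t : ℂ)⁻¹ := by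
    push_cast; field_simp; ring
  rw [levinResidual, h2, wSigma_div_one_add ht, Pi.mul_apply]
  ring

theorem div_one_add_mem_Icc {t : ℝ} (ht : 0 ≤ t) : t / (1 + t) ∈ Icc (0 : ℝ) 1 :=
  ⟨by positivity, (div_le_one (by positivity)).2 (by linarith)⟩

theorem tendsto_levinPrimitive (x y z : ℝ) (hy : y < 0) (P : Polynomial ℂ) :
    Filter.Tendsto (levinPrimitive x y z P) Filter.atTop (nhds 0) := by
  obtain ⟨C, hC⟩ := isCompact_Icc.exists_bound_of_continuousOn (s := Icc (0 : ℝ) 1)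
    (P.continuous.comp Complex.continuous_ofReal).continuousOn
  have hg : Filter.Tendsto (fun t : ℝ => Real.exp y * Real.exp (-(-y) * t ^ 2))
      Filter.atTop (nhds 0) := by
    rw [← mul_zero (Real.exp y)]
    refine (Real.tendsto_exp_atBot.comp ?_).const_mul _
    exact (Filter.tendsto_pow_atTop two_ne_zero).const_mul_atTop_of_neg (by linarith)
  refine squeeze_zero_norm' ?_ (by simpa only [mul_zero] using hg.const_mul C)
  filter_upwards [Filter.eventually_ge_atTop 0] with t ht
  have hi : ‖(1 + t : ℂ)⁻¹‖ ≤ 1 := by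
    rw [norm_inv, ← Complex.ofReal_one, ← Complex.ofReal_add, Complex.norm_real,
      Real.norm_of_nonneg (by positivity)]
    exact inv_le_one_of_one_le₀ (by linarith)
  have hPt := hC _ (div_one_add_mem_Icc ht)
  rw [levinPrimitive, norm_mul, norm_mul, norm_exp_wPhase]
  refine mul_le_mul_of_nonneg_right ?_ (by positivity)
  calc _ ≤ 1 * C := mul_le_mul hi hPt (norm_nonneg _) zero_le_one
    _ = C := one_mul C

theorem integrable_exp_wPhase (x y z : ℝ) (hy : y < 0) :
    Integrable fun t => Complex.exp (wPhase t x y z) := by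
  refine ((integrable_exp_neg_mul_sq (neg_pos.2 hy)).const_mul (Real.exp y)).mono' ?_ ?_
  · have : Continuous fun t => wPhase t x y z :=
      continuous_iff_continuousAt.2 fun t => (hasDerivAt_wPhase t x y z).continuousAt
    exact this.cexp.aestronglyMeasurable
  · exact .of_forall fun t => (norm_exp_wPhase t x y z).le

/-- A posteriori error bound for the Levin-type polynomial approximation of the wavelike
integral: for `y < 0` and a polynomial `P`, with residual
`r(τ) = (1-τ)³P'(τ) + [σ(τ)-(1-τ)²]P(τ) - 1`,
`|∫₀^∞ e^{ϖ} dt + e^{y+ix}P(0)| ≤ (√π/(2√(-y))) e^y · max_{[0,1]}|r|`. -/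
theorem levin_error_bound (x y z : ℝ) (hy : y < 0) (P : Polynomial ℂ) :
    ‖(∫ t in Set.Ioi (0 : ℝ), Complex.exp (wPhase t x y z)) +
        Complex.exp ((y : ℂ) + Complex.I * (x : ℂ)) * P.eval 0‖ ≤
      Real.sqrt Real.pi / (2 * Real.sqrt (-y)) * Real.exp y *
        ⨆ τ : Set.Icc (0 : ℝ) 1,
          ‖(1 - ((τ : ℝ) : ℂ)) ^ 3 * P.derivative.eval ((τ : ℝ) : ℂ) +
              (wSigma (τ : ℝ) x y z - (1 - ((τ : ℝ) : ℂ)) ^ 2) * P.eval ((τ : ℝ) : ℂ) - 1‖ := by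
  set M := ⨆ τ : Icc (0 : ℝ) 1, ‖levinResidual x y z P τ‖
  change _ ≤ _ * M
  have hbound {t : ℝ} (ht : 0 ≤ t) : ‖levinResidual x y z P (t / (1 + t))‖ ≤ M := by
    have hb : BddAbove (range fun τ : Icc (0 : ℝ) 1 => ‖levinResidual x y z P τ‖) :=
      (isCompact_range
        ((continuous_levinResidual x y z P).comp continuous_subtype_val).norm).bddAbove
    exact le_ciSup hb ⟨_, div_one_add_mem_Icc ht⟩
  have hE := (integrable_exp_wPhase x y z hy).integrableOn (s := Ioi 0)
  have hR : IntegrableOn (fun t : ℝ => levinResidual x y z P (t / (1 + t)) *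
      Complex.exp (wPhase t x y z)) (Ioi 0) := by
    refine hE.bdd_mul (c := M) ?_ ?_
    · exact ((continuous_levinResidual x y z P).measurable.comp
        (measurable_id.div (measurable_id.const_add 1))).aestronglyMeasurable
    · exact (ae_restrict_iff' measurableSet_Ioi).2 (.of_forall fun t ht => hbound (le_of_lt ht))
  have hFTC := integral_Ioi_of_hasDerivAt_of_tendsto'
    (fun t ht => hasDerivAt_levinPrimitive ht x y z P)
    ((hR.add hE).congr_fun (fun t _ => by simp [add_mul]) measurableSet_Ioi)
    (tendsto_levinPrimitive x y z hy P)
  simp only [add_mul, one_mul] at hFTC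
  rw [integral_add hR hE] at hFTC
  have h0 : levinPrimitive x y z P 0 = Complex.exp ((y : ℂ) + Complex.I * x) * P.eval 0 := by
    simp [levinPrimitive, wPhase, mul_comm]
  rw [h0] at hFTC
  rw [show (∫ t in Ioi (0 : ℝ), Complex.exp (wPhase t x y z)) +
      Complex.exp ((y : ℂ) + Complex.I * x) * P.eval 0 =
      -∫ t in Ioi (0 : ℝ), levinResidual x y z P (t / (1 + t)) * Complex.exp (wPhase t x y z) by
    linear_combination hFTC, norm_neg]
  calc _ ≤ ∫ t in Ioi (0 : ℝ), M * (Real.exp y * Real.exp (-(-y) * t ^ 2)) := by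
        refine norm_integral_le_of_norm_le ?_ ?_
        · exact (((integrable_exp_neg_mul_sq (neg_pos.2 hy)).const_mul _).const_mul _).integrableOn
        · refine (ae_restrict_iff' measurableSet_Ioi).2 (.of_forall fun t ht => ?_)
          rw [norm_mul, norm_exp_wPhase]
          gcongr
          exact hbound (le_of_lt ht)
    _ = _ := by
        rw [integral_const_mul, integral_const_mul, integral_gaussian_Ioi,
          Real.sqrt_div Real.pi_pos.le]
        ring
end

section
/- Let x ≤ 0, y < 0, z ≤ 0, and let θ ∈ [-π/4, 0] be the steepest-descent angle defined by cos 2θ = -y/√(y²+z²) and sin 2θ = z/√(y²+z²). Then the contour of the wavelike integral may be rotated: ∫₀^∞ e^{ϖ(t,x,y,z)} dt = e^{iθ} ∫₀^∞ e^{ϖ(e^{iθ}t,x,y,z)} dt, where ϖ is extended to complex arguments by the principal branch of the square root (note Re(1 + e^{2iθ}t²) > 0 for all t ≥ 0), and the rotated integral converges absolutely. -/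
open MeasureTheory Set

/-- The phase extended to complex arguments via the principal branch of the square root. -/
noncomputable def wPhaseC (w : ℂ) (x y z : ℝ) : ℂ :=
  (y : ℂ) * (1 + w ^ 2) + Complex.I * ((x : ℂ) + (z : ℂ) * w) * (1 + w ^ 2) ^ ((1 : ℂ) / 2)

open Filter Topology

/-- On a truncated ray, the substitution `t = exp u` in a contour integral. -/
lemma integral_exp_mul_comp_exp_add_mul_I {f : ℂ → ℂ} {α : ℝ}
    (hf : ∀ r : ℝ, 0 < r → DifferentiableAt ℂ f (Complex.exp (Complex.I * α) * r)) (a b : ℝ) :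
    ∫ u in a..b, Complex.exp (u + α * Complex.I) * f (Complex.exp (u + α * Complex.I)) =
      Complex.exp (Complex.I * α) *
        ∫ t in Real.exp a..Real.exp b, f (Complex.exp (Complex.I * α) * t) := by
  have hsubst := intervalIntegral.integral_deriv_smul_comp' (a := a) (b := b)
    (f := Real.exp) (f' := Real.exp)
    (g := fun t : ℝ => f (Complex.exp (Complex.I * α) * t))
    (fun u _ => Real.hasDerivAt_exp u) Real.continuous_exp.continuousOn
    (by
      rintro _ ⟨u, -, rfl⟩
      refine ContinuousAt.continuousWithinAt ?_
      exact ContinuousAt.comp (g := f) (hf _ (Real.exp_pos u)).continuousAt (by fun_prop))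
  rw [← hsubst, ← intervalIntegral.integral_const_mul]
  congr 1
  ext u
  have hu : Complex.exp (u + α * Complex.I) = Complex.exp (Complex.I * α) * Real.exp u := by
    rw [Complex.ofReal_exp, ← Complex.exp_add]
    ring_nf
  simp only [Function.comp_apply, hu, Complex.real_smul]
  ring

/-- A function on a ray with Gaussian decay is integrable. -/
lemma integrableOn_ray_of_norm_le_exp_neg_mul_sq {f : ℂ → ℂ} {α c : ℝ} (hc : 0 < c)
    (hf : ∀ r : ℝ, 0 < r → DifferentiableAt ℂ f (Complex.exp (Complex.I * α) * r))
    (hbound : ∀ r : ℝ, 0 < r →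
      ‖f (Complex.exp (Complex.I * α) * r)‖ ≤ Real.exp (-c * r ^ 2)) :
    IntegrableOn (fun t : ℝ => f (Complex.exp (Complex.I * α) * t)) (Ioi 0) := by
  refine Integrable.mono' (integrable_exp_neg_mul_sq hc).integrableOn ?_ ?_
  · refine ContinuousOn.aestronglyMeasurable (fun r hr => ?_) measurableSet_Ioi
    refine ContinuousAt.continuousWithinAt ?_
    exact ContinuousAt.comp (g := f) (hf r hr).continuousAt (by fun_prop)
  · exact (ae_restrict_mem measurableSet_Ioi).mono fun r hr => hbound r hr

/-- Truncations of an integral over `(0, ∞)` to `(exp (-n), exp n)` converge. -/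
lemma tendsto_intervalIntegral_exp {g : ℝ → ℂ} (hg : IntegrableOn g (Ioi 0)) :
    Tendsto (fun n : ℝ => ∫ t in Real.exp (-n)..Real.exp n, g t) atTop
      (𝓝 (∫ t in Ioi 0, g t)) := by
  have hcover : AECover (volume.restrict (Ioi (0 : ℝ))) atTop
      fun n : ℝ => Ioc (Real.exp (-n)) (Real.exp n) :=
    (aecover_Ioi_of_Ioi (Real.tendsto_exp_atBot.comp tendsto_neg_atTop_atBot)).inter
      (aecover_Iic Real.tendsto_exp_atTop)
  refine (hcover.integral_tendsto_of_countably_generated hg).congr' ?_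
  filter_upwards [eventually_ge_atTop (0 : ℝ)] with n hn
  rw [intervalIntegral.integral_of_le (Real.exp_le_exp.2 (by linarith)),
    Measure.restrict_restrict measurableSet_Ioc, inter_eq_left.2]
  exact fun t ht => (Real.exp_pos _).trans ht.1

/-- Contour rotation for a function holomorphic with Gaussian decay on a sector. -/
lemma integral_ray_eq_integral_ray {f : ℂ → ℂ} {α β c : ℝ} (hc : 0 < c)
    (hf : ∀ φ ∈ uIcc α β, ∀ r : ℝ, 0 < r →
      DifferentiableAt ℂ f (Complex.exp (Complex.I * φ) * r))
    (hbound : ∀ φ ∈ uIcc α β, ∀ r : ℝ, 0 < r →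
      ‖f (Complex.exp (Complex.I * φ) * r)‖ ≤ Real.exp (-c * r ^ 2)) :
    Complex.exp (Complex.I * α) * ∫ t in Ioi (0 : ℝ), f (Complex.exp (Complex.I * α) * t) =
      Complex.exp (Complex.I * β) * ∫ t in Ioi (0 : ℝ), f (Complex.exp (Complex.I * β) * t) := by
  set h : ℂ → ℂ := fun ζ => Complex.exp ζ * f (Complex.exp ζ) with hh
  have hexp (u φ : ℝ) : Complex.exp (u + φ * Complex.I) =
      Complex.exp (Complex.I * φ) * Real.exp u := by
    rw [Complex.ofReal_exp, ← Complex.exp_add]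
    ring_nf
  have hlim (φ : ℝ) (hφ : φ ∈ uIcc α β) :
      Tendsto (fun n : ℝ => ∫ u in -n..n, h (u + φ * Complex.I)) atTop
        (𝓝 (Complex.exp (Complex.I * φ) *
          ∫ t in Ioi (0 : ℝ), f (Complex.exp (Complex.I * φ) * t))) := by
    simp only [hh, integral_exp_mul_comp_exp_add_mul_I (hf φ hφ)]
    exact (tendsto_intervalIntegral_exp (integrableOn_ray_of_norm_le_exp_neg_mul_sq hc
      (hf φ hφ) (hbound φ hφ))).const_mul _
  have hnorm (u φ : ℝ) (hφ : φ ∈ uIcc α β) :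
      ‖h (u + φ * Complex.I)‖ ≤ Real.exp u * Real.exp (-c * Real.exp u ^ 2) := by
    rw [hh]
    simp only [norm_mul, hexp]
    have h1 : ‖Complex.exp (Complex.I * φ)‖ = 1 := by
      rw [mul_comm, Complex.norm_exp_ofReal_mul_I]
    rw [h1, one_mul, Complex.norm_real, Real.norm_of_nonneg (Real.exp_pos u).le]
    gcongr
    exact hbound φ hφ _ (Real.exp_pos u)
  have hright (n φ : ℝ) (hφ : φ ∈ uIcc α β) :
      ‖h (n + φ * Complex.I)‖ ≤ c⁻¹ * Real.exp (-n) := by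
    refine (hnorm n φ hφ).trans ?_
    have hp := Real.exp_pos n
    have h1 := Real.add_one_le_exp (c * Real.exp n ^ 2)
    have h2 : Real.exp (-c * Real.exp n ^ 2) ≤ (c * Real.exp n ^ 2)⁻¹ := by
      rw [neg_mul, Real.exp_neg]
      gcongr
      linarith
    calc Real.exp n * Real.exp (-c * Real.exp n ^ 2)
        ≤ Real.exp n * (c * Real.exp n ^ 2)⁻¹ := by gcongr
      _ = c⁻¹ * Real.exp (-n) := by rw [Real.exp_neg]; field_simp
  have hleft (n φ : ℝ) (hφ : φ ∈ uIcc α β) :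
      ‖h ((-n : ℝ) + φ * Complex.I)‖ ≤ Real.exp (-n) := by
    refine (hnorm (-n) φ hφ).trans (mul_le_of_le_one_right (Real.exp_pos _).le ?_)
    exact Real.exp_le_one_iff.2 (by nlinarith [sq_nonneg (Real.exp (-n))])
  have hdiff : Tendsto (fun n : ℝ => (∫ u in -n..n, h (u + α * Complex.I)) -
      ∫ u in -n..n, h (u + β * Complex.I)) atTop (𝓝 0) := by
    have hzero : Tendsto (fun n : ℝ => Real.exp (-n) * |β - α| +
        c⁻¹ * Real.exp (-n) * |β - α|) atTop (𝓝 0) := by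
      have he := Real.tendsto_exp_neg_atTop_nhds_zero
      simpa using (he.mul_const |β - α|).add ((he.const_mul c⁻¹).mul_const |β - α|)
    refine squeeze_zero_norm (fun n => ?_) hzero
    have hrect := Complex.integral_boundary_rect_eq_zero_of_differentiableOn h
      ⟨-n, α⟩ ⟨n, β⟩ (by
        intro ζ hζ
        have hd := hf ζ.im hζ.2 _ (Real.exp_pos ζ.re)
        rw [← hexp, Complex.re_add_im] at hd
        exact (Complex.differentiableAt_exp.mul
          (hd.comp ζ Complex.differentiableAt_exp)).differentiableWithinAt)
    have hR := intervalIntegral.norm_integral_le_of_norm_le_const (a := α) (b := β)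
      (f := fun φ : ℝ => h (n + φ * Complex.I))
      fun φ hφ => hright n φ (uIoc_subset_uIcc hφ)
    have hL := intervalIntegral.norm_integral_le_of_norm_le_const (a := α) (b := β)
      (f := fun φ : ℝ => h ((-n : ℝ) + φ * Complex.I))
      fun φ hφ => hleft n φ (uIoc_subset_uIcc hφ)
    simp only [smul_eq_mul] at hrect
    have heq : (∫ u in -n..n, h (u + α * Complex.I)) - ∫ u in -n..n, h (u + β * Complex.I) =
        Complex.I * (∫ φ in α..β, h ((-n : ℝ) + φ * Complex.I)) -
          Complex.I * ∫ φ in α..β, h (n + φ * Complex.I) := by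
      linear_combination hrect
    rw [heq]
    refine (norm_sub_le _ _).trans ?_
    simp only [norm_mul, Complex.norm_I, one_mul]
    exact add_le_add hL hR
  exact sub_eq_zero.1 (tendsto_nhds_unique
    ((hlim α left_mem_uIcc).sub (hlim β right_mem_uIcc)) hdiff)

lemma one_add_sq_mem_slitPlane {w : ℂ} (hw : 0 < w.re) : 1 + w ^ 2 ∈ Complex.slitPlane := by
  rw [Complex.mem_slitPlane_iff]
  by_cases him : w.im = 0
  · left
    simp [pow_two, him]
    positivity
  · right
    have := mul_ne_zero hw.ne' him
    simp only [pow_two, Complex.add_im, Complex.one_im, Complex.mul_im]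
    intro h0
    apply this
    linarith

lemma differentiableAt_wPhaseC {w : ℂ} (hw : 0 < w.re) (x y z : ℝ) :
    DifferentiableAt ℂ (fun w => wPhaseC w x y z) w := by
  have := one_add_sq_mem_slitPlane hw
  unfold wPhaseC
  fun_prop (disch := assumption)

lemma cpow_half_re_pos {q : ℂ} (hq : q ∈ Complex.slitPlane) : 0 < (q ^ ((1 : ℂ) / 2)).re := by
  rw [Complex.cpow_def_of_ne_zero (Complex.slitPlane_ne_zero hq), Complex.exp_re]
  refine mul_pos (Real.exp_pos _) (Real.cos_pos_of_mem_Ioo ?_)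
  have him : (Complex.log q * (1 / 2)).im = q.arg / 2 := by
    rw [show (1 / 2 : ℂ) = ((1 / 2 : ℝ) : ℂ) by norm_num, Complex.im_mul_ofReal, Complex.log_im]
    ring
  have h1 := Complex.neg_pi_lt_arg q
  have h2 := (Complex.arg_le_pi q).lt_of_ne (Complex.mem_slitPlane_iff_arg.1 hq).1
  rw [him]
  constructor <;> linarith

/-- In the fourth quadrant the real part of the phase is dominated by its quadratic part. -/
lemma wPhaseC_re_le {w : ℂ} (hre : 0 < w.re) (him : w.im ≤ 0) {x z : ℝ} (hx : x ≤ 0)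
    (hz : z ≤ 0) (y : ℝ) : (wPhaseC w x y z).re ≤ y * (1 + (w ^ 2).re) := by
  have hs := cpow_half_re_pos (one_add_sq_mem_slitPlane hre)
  have hsq : ((1 + w ^ 2) ^ ((1 : ℂ) / 2)) ^ 2 = 1 + w ^ 2 := by
    rw [one_div]
    exact Complex.cpow_ofNat_inv_pow _ 2
  unfold wPhaseC
  set s := (1 + w ^ 2) ^ ((1 : ℂ) / 2)
  have hsim : s.im ≤ 0 := by
    have h1 := congrArg Complex.im hsq
    simp only [pow_two, Complex.add_im, Complex.one_im, Complex.mul_im] at h1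
    have h2 := mul_nonpos_of_nonneg_of_nonpos hre.le him
    by_contra! h3
    nlinarith [mul_pos hs h3]
  have h1 : 0 ≤ x * s.im := mul_nonneg_of_nonpos_of_nonpos hx hsim
  have h2 : 0 ≤ z * (w.re * s.im + w.im * s.re) :=
    mul_nonneg_of_nonpos_of_nonpos hz (add_nonpos
      (mul_nonpos_of_nonneg_of_nonpos hre.le hsim) (mul_nonpos_of_nonpos_of_nonneg him hs.le))
  simp only [Complex.add_re, Complex.mul_re, Complex.mul_im, Complex.add_im, Complex.I_re,
    Complex.I_im, Complex.ofReal_re, Complex.ofReal_im, Complex.one_re]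
  nlinarith

lemma wPhaseC_ofReal (t x y z : ℝ) : wPhaseC t x y z = wPhase t x y z := by
  have h : (0 : ℝ) ≤ 1 + t ^ 2 := by positivity
  unfold wPhaseC wPhase
  rw [Real.sqrt_eq_rpow, Complex.ofReal_cpow h]
  push_cast
  ring

lemma exp_I_mul_mul_ofReal_sq_re (φ t : ℝ) :
    ((Complex.exp (Complex.I * φ) * t) ^ 2).re = Real.cos (2 * φ) * t ^ 2 := by
  rw [mul_pow, ← Complex.exp_nat_mul, ← Complex.ofReal_pow, Complex.re_mul_ofReal,
    show ((2 : ℕ) : ℂ) * (Complex.I * φ) = ((2 * φ : ℝ) : ℂ) * Complex.I by push_cast; ring,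
    Complex.exp_ofReal_mul_I_re]

/-- Rotation of the contour of the wavelike integral along the steepest-descent direction
for `x ≤ 0`, `y < 0`, `z ≤ 0`: with `θ ∈ [-π/4,0]` defined by `cos 2θ = -y/√(y²+z²)`,
`sin 2θ = z/√(y²+z²)`, one has `Re(1+e^{2iθ}t²) > 0` for `t ≥ 0`,
the rotated integral converges absolutely, and
`∫₀^∞ e^{ϖ(t)} dt = e^{iθ} ∫₀^∞ e^{ϖ(e^{iθ}t)} dt`. -/
theorem contour_rotation_z_nonpos (x y z θ : ℝ) (hx : x ≤ 0) (hy : y < 0) (hz : z ≤ 0)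
    (hθ : θ ∈ Set.Icc (-(Real.pi / 4)) 0)
    (hcos : Real.cos (2 * θ) = -y / Real.sqrt (y ^ 2 + z ^ 2))
    (hsin : Real.sin (2 * θ) = z / Real.sqrt (y ^ 2 + z ^ 2)) :
    (∀ t : ℝ, 0 ≤ t → 0 < (1 + (Complex.exp (Complex.I * (θ : ℂ)) * (t : ℂ)) ^ 2).re) ∧
    IntegrableOn
      (fun t : ℝ => Complex.exp (wPhaseC (Complex.exp (Complex.I * (θ : ℂ)) * (t : ℂ)) x y z))
      (Set.Ioi 0) ∧
    ∫ t in Set.Ioi (0 : ℝ), Complex.exp (wPhase t x y z) =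
      Complex.exp (Complex.I * (θ : ℂ)) *
        ∫ t in Set.Ioi (0 : ℝ),
          Complex.exp (wPhaseC (Complex.exp (Complex.I * (θ : ℂ)) * (t : ℂ)) x y z) := by
  have hcos_pos : 0 < Real.cos (2 * θ) := by
    rw [hcos]
    have : 0 < y ^ 2 + z ^ 2 := add_pos_of_pos_of_nonneg (sq_pos_of_neg hy) (sq_nonneg z)
    exact div_pos (neg_pos.2 hy) (Real.sqrt_pos.2 this)
  have hpi := Real.pi_pos
  have hangle : ∀ φ ∈ uIcc 0 θ, θ ≤ φ ∧ φ ≤ 0 := fun φ hφ => by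
    rwa [uIcc_of_ge hθ.2] at hφ
  have hre : ∀ φ ∈ uIcc 0 θ, ∀ r : ℝ, 0 < r →
      0 < (Complex.exp (Complex.I * φ) * r).re := fun φ hφ r hr => by
    obtain ⟨h1, h2⟩ := hangle φ hφ
    rw [Complex.re_mul_ofReal, mul_comm Complex.I, Complex.exp_ofReal_mul_I_re]
    exact mul_pos (Real.cos_pos_of_mem_Ioo ⟨by linarith [hθ.1], by linarith⟩) hr
  have him : ∀ φ ∈ uIcc 0 θ, ∀ r : ℝ, 0 < r →
      (Complex.exp (Complex.I * φ) * r).im ≤ 0 := fun φ hφ r hr => by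
    obtain ⟨h1, h2⟩ := hangle φ hφ
    rw [Complex.im_mul_ofReal, mul_comm Complex.I, Complex.exp_ofReal_mul_I_im]
    exact mul_nonpos_of_nonpos_of_nonneg
      (Real.sin_nonpos_of_nonpos_of_neg_pi_le h2 (by linarith [hθ.1])) hr.le
  have hc : 0 < -y * Real.cos (2 * θ) := mul_pos (neg_pos.2 hy) hcos_pos
  have hdiff : ∀ φ ∈ uIcc 0 θ, ∀ r : ℝ, 0 < r →
      DifferentiableAt ℂ (fun w => Complex.exp (wPhaseC w x y z))
        (Complex.exp (Complex.I * φ) * r) :=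
    fun φ hφ r hr => (differentiableAt_wPhaseC (hre φ hφ r hr) x y z).cexp
  have hbound : ∀ φ ∈ uIcc 0 θ, ∀ r : ℝ, 0 < r →
      ‖Complex.exp (wPhaseC (Complex.exp (Complex.I * φ) * r) x y z)‖ ≤
        Real.exp (-(-y * Real.cos (2 * θ)) * r ^ 2) := fun φ hφ r hr => by
    obtain ⟨h1, h2⟩ := hangle φ hφ
    have hle := wPhaseC_re_le (hre φ hφ r hr) (him φ hφ r hr) hx hz y
    rw [exp_I_mul_mul_ofReal_sq_re] at hle
    have hcos_le : Real.cos (2 * θ) ≤ Real.cos (2 * φ) := by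
      rw [← Real.cos_neg (2 * θ), ← Real.cos_neg (2 * φ)]
      exact Real.cos_le_cos_of_nonneg_of_le_pi (by linarith) (by linarith [hθ.1]) (by linarith)
    rw [Complex.norm_exp, Real.exp_le_exp]
    nlinarith [mul_le_mul_of_nonneg_right hcos_le (sq_nonneg r)]
  refine ⟨fun t _ => ?_, integrableOn_ray_of_norm_le_exp_neg_mul_sq hc
    (hdiff θ right_mem_uIcc) (hbound θ right_mem_uIcc), ?_⟩
  · rw [Complex.add_re, Complex.one_re, exp_I_mul_mul_ofReal_sq_re]
    positivity
  · rw [← integral_ray_eq_integral_ray hc hdiff hbound]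
    simp [wPhaseC_ofReal]
end

section
/- Let x ≤ 0, y ≤ 0, z > 0 (so y² + z² ≠ 0), and let θ ∈ (0, π/4] be the steepest-descent angle defined by cos 2θ = -y/√(y²+z²) and sin 2θ = z/√(y²+z²). Set t* = |x| sin θ / (2(|y| cos θ + z sin θ)) and γ(t) = t* + t e^{iθ}. Then for all t ≥ 0: |x|·Im(γ(t)) ≤ z·Im(γ(t)²) + |y|·(1 + Re(γ(t)²)). -/
open MeasureTheory Set

/-- The inequality determining the splitting point `t*` for the shifted and rotated contour
`γ(t) = t* + t e^{iθ}` in the steepest-descent evaluation when `z > 0`: for all `t ≥ 0`,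
`|x|·Im γ(t) ≤ z·Im(γ(t)²) + |y|·(1 + Re(γ(t)²))`. -/
theorem contour_split_inequality (x y z θ tstar : ℝ) (γ : ℝ → ℂ)
    (hx : x ≤ 0) (hy : y ≤ 0) (hz : 0 < z)
    (hθ : θ ∈ Set.Ioc 0 (Real.pi / 4))
    (hcos : Real.cos (2 * θ) = -y / Real.sqrt (y ^ 2 + z ^ 2))
    (hsin : Real.sin (2 * θ) = z / Real.sqrt (y ^ 2 + z ^ 2))
    (htstar : tstar = |x| * Real.sin θ / (2 * (|y| * Real.cos θ + z * Real.sin θ)))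
    (hγ : ∀ t : ℝ, γ t = (tstar : ℂ) + (t : ℂ) * Complex.exp (Complex.I * (θ : ℂ))) :
    ∀ t : ℝ, 0 ≤ t →
      |x| * (γ t).im ≤ z * ((γ t) ^ 2).im + |y| * (1 + ((γ t) ^ 2).re) := by
  intro t ht
  obtain ⟨hθ0, hθ1⟩ := hθ
  have hs : 0 < Real.sin θ := Real.sin_pos_of_pos_of_lt_pi hθ0 (by linarith [Real.pi_pos])
  have hc : 0 < Real.cos θ :=
    Real.cos_pos_of_mem_Ioo ⟨by linarith [Real.pi_pos], by linarith [Real.pi_pos]⟩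
  have hden : 0 < |y| * Real.cos θ + z * Real.sin θ := by positivity
  have hlin : 2 * tstar * (|y| * Real.cos θ + z * Real.sin θ) = |x| * Real.sin θ := by
    rw [htstar]
    field_simp
  have hcos_nonneg : 0 ≤ Real.cos (2 * θ) := by
    rw [hcos]
    exact div_nonneg (by linarith) (Real.sqrt_nonneg _)
  have hsin_nonneg : 0 ≤ Real.sin (2 * θ) := by
    rw [hsin]
    positivity
  have hre : (γ t).re = tstar + t * Real.cos θ := by
    rw [hγ, mul_comm Complex.I]
    simp [Complex.exp_ofReal_mul_I_re]
  have him : (γ t).im = t * Real.sin θ := by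
    rw [hγ, mul_comm Complex.I]
    simp [Complex.exp_ofReal_mul_I_im]
  have hquad : 0 ≤ t ^ 2 * (z * Real.sin (2 * θ) + |y| * Real.cos (2 * θ))
      + |y| * (1 + tstar ^ 2) := by positivity
  rw [Real.sin_two_mul, Real.cos_two_mul'] at hquad
  simp only [sq, Complex.mul_re, Complex.mul_im, hre, him]
  linear_combination hquad - t * hlin
end
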